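/- arXiv:1806.10336 — 8 statements merged into one kernel-verified Lean document; each statement's English description precedes it below -/
import Mathlib

section
/- Let b ≥ 2 be an integer and let α be a real number that is normal to base b. Then the sequence ({b^n α})_{n≥1} has no non-trivial bounded remainder set: no interval [a,c) ⊆ [0,1) with 0 < c − a < 1 is a BRS for ({b^n α})_{n≥1}. -/
open Finset Filter

/-- Number of indices `1 ≤ n ≤ N` with `x n ∈ [a, b)`. -/
noncomputable def cnt (x : ℕ → ℝ) (a b : ℝ) (N : ℕ) : ℕ :=
  ((Finset.Icc 1 N).filter (fun n => x n ∈ Set.Ico a b)).card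

/-- `[a, b)` is a bounded remainder set (BRS) for the sequence `x`:
`|N * D_N([a,b))| = |#{1 ≤ n ≤ N : x n ∈ [a,b)} - N (b - a)| ≤ c` for all `N`. -/
noncomputable def IsBRS (x : ℕ → ℝ) (a b : ℝ) : Prop :=
  ∃ c : ℝ, ∀ N : ℕ, 1 ≤ N → |((cnt x a b N : ℝ)) - (N : ℝ) * (b - a)| ≤ c

/-- `[a, b)` is a strongly non-bounded remainder set (S-NBRS) for `x`: for every `K`
there are `K` successive elements all in `[a,b)` or all outside `[a,b)`. -/
def IsSNBRS (x : ℕ → ℝ) (a b : ℝ) : Prop :=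
  ∀ K : ℕ, ∃ N : ℕ,
    (∀ k : ℕ, 1 ≤ k → k ≤ K → x (N + k) ∈ Set.Ico a b) ∨
    (∀ k : ℕ, 1 ≤ k → k ≤ K → x (N + k) ∉ Set.Ico a b)

/-- The sequence `x` has a dense collection of BRS. -/
noncomputable def HasDenseBRS (x : ℕ → ℝ) : Prop :=
  ∀ ε : ℝ, 0 < ε → ∀ u v : ℝ, u ∈ Set.Ico (0 : ℝ) 1 → v ∈ Set.Ico (0 : ℝ) 1 →
    ∃ a b : ℝ, 0 ≤ a ∧ a ≤ b ∧ b ≤ 1 ∧ IsBRS x a b ∧ |a - u| < ε ∧ |b - v| < ε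

/-- The sequence `x` is uniformly distributed modulo 1. -/
noncomputable def IsUD (x : ℕ → ℝ) : Prop :=
  ∀ a b : ℝ, 0 ≤ a → a ≤ b → b ≤ 1 →
    Tendsto (fun N : ℕ => (cnt x a b N : ℝ) / (N : ℝ)) atTop (nhds (b - a))

/-- The `i`-th digit (for `i ≥ 1`) in the base-`b` expansion of `α`
(the digit expansion of the fractional part of `α`). -/
noncomputable def digit (b : ℕ) (α : ℝ) (i : ℕ) : ℕ :=
  (⌊α * (b : ℝ) ^ i⌋ % (b : ℤ)).toNat

/-- `α` is normal to the integer base `b`: every block `(w 0, …, w (k-1))` of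
digits occurs in the base-`b` digit expansion of `α` with asymptotic frequency `b ^ (-k)`. -/
noncomputable def IsNormal (b : ℕ) (α : ℝ) : Prop :=
  ∀ k : ℕ, 1 ≤ k → ∀ w : Fin k → Fin b,
    Tendsto
      (fun N : ℕ =>
        (((Finset.Icc 1 N).filter (fun n => ∀ j : Fin k, digit b α (n + (j : ℕ)) = (w j : ℕ))).card : ℝ)
          / (N : ℝ))
      atTop (nhds (((b : ℝ) ^ k)⁻¹))

/-- A vanishing digit makes the corresponding step of the orbit an exact multiplication by `b`. -/
lemma fract_mul_of_digit_eq_zero {b : ℕ} (hb : 2 ≤ b) {α : ℝ} {n : ℕ}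
    (h : digit b α (n + 1) = 0) :
    Int.fract ((b : ℝ) ^ n * α) * b = Int.fract ((b : ℝ) ^ (n + 1) * α) := by
  have hb0 : (0 : ℝ) < b := by exact_mod_cast (by omega : 0 < b)
  have hbz : (0 : ℤ) < b := by omega
  set y := Int.fract ((b : ℝ) ^ n * α) with hy
  have hy0 : 0 ≤ y := Int.fract_nonneg _
  have hy1 : y < 1 := Int.fract_lt_one _
  have hexp : (b : ℝ) ^ (n + 1) * α = y * b + ((b * ⌊(b : ℝ) ^ n * α⌋ : ℤ) : ℝ) := by
    rw [hy, Int.fract]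
    push_cast
    ring
  have hfl0 : 0 ≤ ⌊y * b⌋ := Int.floor_nonneg.mpr (by positivity)
  have hfl1 : ⌊y * b⌋ < b := Int.floor_lt.mpr (by push_cast; nlinarith)
  have hfl : ⌊y * b⌋ = 0 := by
    rw [digit, mul_comm α, hexp, Int.floor_add_intCast, Int.add_mul_emod_self_left,
      Int.emod_eq_of_lt hfl0 hfl1] at h
    omega
  rw [hexp, Int.fract_add_intCast, Int.fract, hfl]
  simp

/-- A run of `m` vanishing digits forces the orbit to be within `b ^ (-m)` of zero. -/
lemma fract_mul_pow_lt_one {b : ℕ} (hb : 2 ≤ b) {α : ℝ} {n m : ℕ}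
    (h : ∀ j < m, digit b α (n + j + 1) = 0) :
    Int.fract ((b : ℝ) ^ n * α) * (b : ℝ) ^ m < 1 := by
  have key : ∀ k ≤ m,
      Int.fract ((b : ℝ) ^ n * α) * (b : ℝ) ^ k = Int.fract ((b : ℝ) ^ (n + k) * α) := by
    intro k hk
    induction k with
    | zero => simp
    | succ k ih =>
      rw [pow_succ, ← mul_assoc, ih (by omega), fract_mul_of_digit_eq_zero hb (h k (by omega))]
      rfl
  rw [key m le_rfl]
  exact Int.fract_lt_one _

/-- The expansion of a normal number contains arbitrarily long runs of zeros. -/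
lemma IsNormal.exists_zero_run {b : ℕ} (hb : 2 ≤ b) {α : ℝ} (hα : IsNormal b α) (L : ℕ) :
    ∃ n, 1 ≤ n ∧ ∀ j < L, digit b α (n + j) = 0 := by
  rcases Nat.eq_zero_or_pos L with rfl | hL
  · exact ⟨1, le_rfl, by simp⟩
  have hb0 : (0 : ℝ) < b := by exact_mod_cast (by omega : 0 < b)
  obtain ⟨N, hN⟩ := ((hα L hL fun _ => ⟨0, by omega⟩).eventually_const_lt
    (inv_pos.mpr (pow_pos hb0 L))).exists
  have hcard : 0 < ((Finset.Icc 1 N).filter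
      (fun n => ∀ j : Fin L, digit b α (n + (j : ℕ)) = 0)).card := by
    by_contra! hzero
    simp [Nat.le_zero.mp hzero] at hN
  obtain ⟨n, hn⟩ := Finset.card_pos.mp hcard
  simp only [Finset.mem_filter, Finset.mem_Icc] at hn
  exact ⟨n, hn.1.1, fun j hj => hn.2 ⟨j, hj⟩⟩

lemma cnt_succ (x : ℕ → ℝ) (a b : ℝ) (N : ℕ) [Decidable (x (N + 1) ∈ Set.Ico a b)] :
    cnt x a b (N + 1) = cnt x a b N + if x (N + 1) ∈ Set.Ico a b then 1 else 0 := by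
  unfold cnt
  rw [← Finset.insert_Icc_right_eq_Icc_add_one (by omega), Finset.filter_insert]
  split_ifs with h <;> simp

lemma cnt_add_of_forall_mem {x : ℕ → ℝ} {a b : ℝ} {N K : ℕ}
    (h : ∀ k, 1 ≤ k → k ≤ K → x (N + k) ∈ Set.Ico a b) :
    cnt x a b (N + K) = cnt x a b N + K := by
  classical
  induction K with
  | zero => rfl
  | succ K ih =>
    rw [← add_assoc, cnt_succ, ih fun k h1 h2 => h k h1 (by omega),
      if_pos (by exact h (K + 1) (by omega) le_rfl), add_assoc]

lemma cnt_add_of_forall_notMem {x : ℕ → ℝ} {a b : ℝ} {N K : ℕ}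
    (h : ∀ k, 1 ≤ k → k ≤ K → x (N + k) ∉ Set.Ico a b) :
    cnt x a b (N + K) = cnt x a b N := by
  classical
  induction K with
  | zero => rfl
  | succ K ih =>
    rw [← add_assoc, cnt_succ, ih fun k h1 h2 => h k h1 (by omega),
      if_neg (by exact h (K + 1) (by omega) le_rfl), add_zero]

/-- The orbit of a normal number stays arbitrarily close to zero for arbitrarily long. -/
lemma IsNormal.exists_run_fract_lt {b : ℕ} (hb : 2 ≤ b) {α : ℝ} (hα : IsNormal b α)
    {ε : ℝ} (hε : 0 < ε) (K : ℕ) :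
    ∃ N, 1 ≤ N ∧ ∀ k, 1 ≤ k → k ≤ K → Int.fract ((b : ℝ) ^ (N + k) * α) < ε := by
  have hb1 : (1 : ℝ) < b := by exact_mod_cast (by omega : 1 < b)
  obtain ⟨m, hm⟩ := pow_unbounded_of_one_lt ε⁻¹ hb1
  obtain ⟨N, hN1, hN⟩ := hα.exists_zero_run hb (K + m + 1)
  refine ⟨N, hN1, fun k _ hk => ?_⟩
  have hlt := fract_mul_pow_lt_one hb (α := α) (n := N + k) (m := m) fun j hj => by
    have := hN (k + j + 1) (by omega)
    rwa [show N + (k + j + 1) = N + k + j + 1 by ring] at this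
  have hpow : (0 : ℝ) < (b : ℝ) ^ m := by positivity
  have hεm : 1 < ε * (b : ℝ) ^ m := by
    rwa [inv_lt_iff_one_lt_mul₀' hε] at hm
  exact lt_of_mul_lt_mul_right (hlt.trans hεm) hpow.le

/-- for an integer base `b ≥ 2` and `α` normal to base `b`, the sequence
`({b^n α})_{n ≥ 1}` has no non-trivial bounded remainder set. -/
theorem no_nontrivial_brs_of_normal (b : ℕ) (hb : 2 ≤ b) (α : ℝ) (hα : IsNormal b α)
    (a c : ℝ) (ha : 0 ≤ a) (hc : c ≤ 1) (hpos : 0 < c - a) (hlt : c - a < 1) :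
    ¬ IsBRS (fun n : ℕ => Int.fract ((b : ℝ) ^ n * α)) a c := by
  rintro ⟨C, hC⟩
  set x : ℕ → ℝ := fun n => Int.fract ((b : ℝ) ^ n * α)
  rcases ha.eq_or_lt with rfl | ha'
  · obtain ⟨K, hK⟩ := exists_nat_gt (2 * C / (1 - (c - 0)))
    obtain ⟨N, hN1, hN⟩ := hα.exists_run_fract_lt hb (by linarith : 0 < c) K
    have hcnt : cnt x 0 c (N + K) = cnt x 0 c N + K :=
      cnt_add_of_forall_mem fun k h1 h2 => ⟨Int.fract_nonneg _, hN k h1 h2⟩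
    have h1 := abs_le.mp (hC N hN1)
    have h2 := abs_le.mp (hC (N + K) (by omega))
    rw [hcnt] at h2
    rw [div_lt_iff₀ (by linarith)] at hK
    push_cast at h2
    linarith [h1.1, h2.2]
  · obtain ⟨K, hK⟩ := exists_nat_gt (2 * C / (c - a))
    obtain ⟨N, hN1, hN⟩ := hα.exists_run_fract_lt hb ha' K
    have hcnt : cnt x a c (N + K) = cnt x a c N :=
      cnt_add_of_forall_notMem fun k h1 h2 h => absurd (hN k h1 h2) (not_lt.mpr h.1)
    have h1 := abs_le.mp (hC N hN1)
    have h2 := abs_le.mp (hC (N + K) (by omega))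
    rw [hcnt] at h2
    rw [div_lt_iff₀ hpos] at hK
    push_cast at h2
    linarith [h1.2, h2.1]
end

section
/- Let b ≥ 2 be an integer and let α be a real number that is normal to base b. Then every interval [a,c) ⊊ [0,1) with a < c is a strongly non-bounded remainder set (S-NBRS) for the sequence ({b^n α})_{n≥1}: for every K ∈ ℕ there exists N such that the K successive elements {b^{N+1}α}, …, {b^{N+K}α} either all lie in [a,c) or all lie outside [a,c). -/
open Finset Filter

/-- Every block of digits occurs in the expansion of a normal number. -/
theorem IsNormal.exists_block {b : ℕ} {α : ℝ} (hb : 2 ≤ b) (hα : IsNormal b α)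
    {k : ℕ} (hk : 1 ≤ k) (w : Fin k → Fin b) :
    ∃ n, 1 ≤ n ∧ ∀ j : Fin k, digit b α (n + (j : ℕ)) = (w j : ℕ) := by
  have hpos : (0 : ℝ) < ((b : ℝ) ^ k)⁻¹ := by positivity
  obtain ⟨N, hN⟩ := ((hα k hk w).eventually (lt_mem_nhds hpos)).exists
  by_contra! hno
  rw [Finset.filter_eq_empty_iff.mpr] at hN
  · simp at hN
  · intro n hn hall
    obtain ⟨j, hj⟩ := hno n (Finset.mem_Icc.mp hn).1
    exact hj (hall j)

/-- Multiplying the fractional part of `b ^ n * α` by `b` shifts out one digit. -/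
theorem mul_fract_pow_mul {b : ℕ} (hb : 0 < b) (α : ℝ) (n : ℕ) :
    (b : ℝ) * Int.fract ((b : ℝ) ^ n * α)
      = digit b α (n + 1) + Int.fract ((b : ℝ) ^ (n + 1) * α) := by
  have hb' : (0 : ℝ) < b := by exact_mod_cast hb
  have hfl : ⌊α * (b : ℝ) ^ (n + 1)⌋ / (b : ℤ) = ⌊(b : ℝ) ^ n * α⌋ := by
    rw [← Int.floor_div_natCast]
    congr 1
    field_simp
    ring
  have hd : ((digit b α (n + 1) : ℕ) : ℤ)
      = ⌊α * (b : ℝ) ^ (n + 1)⌋ - b * ⌊(b : ℝ) ^ n * α⌋ := by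
    rw [digit, Int.toNat_of_nonneg (Int.emod_nonneg _ (by omega)), Int.emod_def, hfl]
  have hd' : (digit b α (n + 1) : ℝ)
      = ⌊α * (b : ℝ) ^ (n + 1)⌋ - b * ⌊(b : ℝ) ^ n * α⌋ := by exact_mod_cast hd
  rw [hd', mul_comm α, Int.fract, Int.fract]
  ring

/-- If the digits following position `n` are constantly `d`, then multiplication by `b ^ L`
expands distances from the fixed point `t` of `x ↦ b * x - d`. -/
theorem pow_mul_fract_sub {b : ℕ} (hb : 0 < b) {α t : ℝ} {d : ℕ}
    (ht : (b : ℝ) * t = d + t) {n : ℕ} (L : ℕ)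
    (h : ∀ i < L, digit b α (n + i + 1) = d) :
    (b : ℝ) ^ L * (Int.fract ((b : ℝ) ^ n * α) - t)
      = Int.fract ((b : ℝ) ^ (n + L) * α) - t := by
  induction L with
  | zero => simp
  | succ L ih =>
    have hstep := mul_fract_pow_mul hb α (n + L)
    rw [h L (by omega)] at hstep
    rw [pow_succ', mul_assoc, ih fun i hi => h i (by omega), mul_sub, hstep, ht, ← add_assoc]
    ring

/-- The orbit of a normal number stays arbitrarily close to a fixed point of the `b`-adic
expansion map for arbitrarily long times. -/
theorem IsNormal.exists_run_near {b : ℕ} {α : ℝ} (hb : 2 ≤ b) (hα : IsNormal b α)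
    (d : Fin b) {t : ℝ} (ht0 : 0 ≤ t) (ht1 : t ≤ 1) (ht : (b : ℝ) * t = (d : ℕ) + t)
    {ε : ℝ} (hε : 0 < ε) (K : ℕ) :
    ∃ N : ℕ, ∀ k : ℕ, 1 ≤ k → k ≤ K → |Int.fract ((b : ℝ) ^ (N + k) * α) - t| < ε := by
  have hb1 : (1 : ℝ) < b := by exact_mod_cast hb
  obtain ⟨L, hL⟩ := pow_unbounded_of_one_lt ε⁻¹ hb1
  obtain ⟨n, hn, hblock⟩ := hα.exists_block hb (k := K + L + 1) (by omega) fun _ => d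
  refine ⟨n - 1, fun k hk hkK => ?_⟩
  have key := pow_mul_fract_sub (α := α) (by omega) ht (n := n - 1 + k) L fun i hi => by
    have := hblock ⟨k + i, by omega⟩
    rwa [show n - 1 + k + i + 1 = n + (k + i) by omega]
  have hle : |Int.fract ((b : ℝ) ^ (n - 1 + k + L) * α) - t| ≤ 1 := by
    rw [abs_le]
    constructor <;>
      linarith [Int.fract_nonneg ((b : ℝ) ^ (n - 1 + k + L) * α),
        Int.fract_lt_one ((b : ℝ) ^ (n - 1 + k + L) * α)]
  have hpow : (0 : ℝ) < (b : ℝ) ^ L := by positivity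
  rw [← key, abs_mul, abs_of_pos hpow] at hle
  have hεL : 1 < (b : ℝ) ^ L * ε := (inv_lt_iff_one_lt_mul₀ hε).mp hL
  exact lt_of_mul_lt_mul_left (hle.trans_lt hεL) hpow.le

/-- for an integer base `b ≥ 2` and `α` normal to base `b`, every
proper interval `[a, c) ⊊ [0,1)` is an S-NBRS for `({b^n α})_{n ≥ 1}`. -/
theorem snbrs_of_normal (b : ℕ) (hb : 2 ≤ b) (α : ℝ) (hα : IsNormal b α)
    (a c : ℝ) (ha : 0 ≤ a) (hac : a < c) (hc : c ≤ 1) (hproper : ¬(a = 0 ∧ c = 1)) :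
    IsSNBRS (fun n : ℕ => Int.fract ((b : ℝ) ^ n * α)) a c := by
  intro K
  rcases ha.eq_or_lt with rfl | ha
  · have hc1 : c < 1 := lt_of_le_of_ne hc fun h => hproper ⟨rfl, h⟩
    obtain ⟨N, hN⟩ := hα.exists_run_near hb ⟨b - 1, by omega⟩ zero_le_one le_rfl
      (by simp [Nat.cast_sub (show 1 ≤ b by omega)]) (sub_pos.mpr hc1) K
    refine ⟨N, Or.inr fun k hk hkK hmem => ?_⟩
    linarith [(abs_lt.mp (hN k hk hkK)).1, hmem.2]
  · obtain ⟨N, hN⟩ := hα.exists_run_near hb ⟨0, by omega⟩ le_rfl zero_le_one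
      (by simp) ha K
    refine ⟨N, Or.inr fun k hk hkK hmem => ?_⟩
    linarith [(abs_lt.mp (hN k hk hkK)).2, hmem.1]
end

section
/- Let p(n) = (p^{(1)}(n), p^{(2)}(n), …, p^{(s)}(n)), where all p^{(i)} are real polynomials with the property that for each lattice point h ∈ ℤ^s, h ≠ 0, the polynomial ⟨h, p(X)⟩ ∈ ℝ[X] has at least one non-constant monomial with irrational coefficient. Then the s-dimensional sequence ({p(n)})_{n≥1} of componentwise fractional parts in [0,1)^s does not have any s-dimensional strongly non-bounded remainder set: for every box B = [a_1,b_1) × ⋯ × [a_s,b_s) ⊊ [0,1)^s of positive volume there exists K ∈ ℕ such that among any K successive elements {p(N+1)}, …, {p(N+K)} at least one lies in B and at least one lies outside B. -/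
section

open Filter Finset ComplexConjugate

/-- The averages of `u` over `K` successive integers tend to zero as `K → ∞`, uniformly in the
starting point. -/
def UniformMeanZero (u : ℕ → ℂ) : Prop :=
  ∀ ε : ℝ, 0 < ε → ∀ᶠ K : ℕ in atTop, ∀ N : ℕ, ‖∑ k ∈ range K, u (N + k)‖ ≤ ε * K

namespace UniformMeanZero

theorem of_eq_zero {u : ℕ → ℂ} (hu : ∀ n, u n = 0) : UniformMeanZero u := by
  intro ε hε
  refine Eventually.of_forall fun K N => ?_
  simp only [hu, sum_const_zero, norm_zero]
  positivity

theorem add {u v : ℕ → ℂ} (hu : UniformMeanZero u) (hv : UniformMeanZero v) :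
    UniformMeanZero fun n => u n + v n := by
  intro ε hε
  filter_upwards [hu (ε / 2) (by positivity), hv (ε / 2) (by positivity)] with K h1 h2 N
  rw [sum_add_distrib]
  linarith [norm_add_le (∑ k ∈ range K, u (N + k)) (∑ k ∈ range K, v (N + k)), h1 N, h2 N]

theorem const_mul {u : ℕ → ℂ} (hu : UniformMeanZero u) (c : ℂ) :
    UniformMeanZero fun n => c * u n := by
  intro ε hε
  filter_upwards [hu (ε / (‖c‖ + 1)) (by positivity)] with K h N
  rw [← mul_sum, norm_mul]
  calc ‖c‖ * ‖∑ k ∈ range K, u (N + k)‖ ≤ (‖c‖ + 1) * (ε / (‖c‖ + 1) * K) := by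
        gcongr
        · linarith
        · exact h N
    _ = ε * K := by field_simp

theorem map_conj {u : ℕ → ℂ} (hu : UniformMeanZero u) :
    UniformMeanZero fun n => conj (u n) := by
  intro ε hε
  filter_upwards [hu ε hε] with K h N
  rw [← map_sum, RCLike.norm_conj]
  exact h N

theorem comp_add {u : ℕ → ℂ} (hu : UniformMeanZero u) (m : ℕ) :
    UniformMeanZero fun n => u (n + m) := by
  intro ε hε
  filter_upwards [hu ε hε] with K h N
  convert h (N + m) using 4
  omega

/-- Uniformly mean zero sequences are closed under uniform approximation. -/
theorem of_approx {u : ℕ → ℂ}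
    (h : ∀ ε : ℝ, 0 < ε → ∃ v : ℕ → ℂ, UniformMeanZero v ∧ ∀ n, ‖u n - v n‖ ≤ ε) :
    UniformMeanZero u := by
  intro ε hε
  obtain ⟨v, hv, huv⟩ := h (ε / 2) (by positivity)
  filter_upwards [hv (ε / 2) (by positivity)] with K hK N
  have h1 : ‖∑ k ∈ range K, (u (N + k) - v (N + k))‖ ≤ ε / 2 * K := by
    refine (norm_sum_le_of_le _ fun k _ => huv (N + k)).trans (le_of_eq ?_)
    simp [mul_comm]
  rw [sum_sub_distrib] at h1
  linarith [norm_le_norm_add_norm_sub' (∑ k ∈ range K, u (N + k)) (∑ k ∈ range K, v (N + k)), hK N]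

end UniformMeanZero

theorem norm_sum_range_shift_sub_le {u : ℕ → ℂ} (hu : ∀ n, ‖u n‖ ≤ 1) (h K N : ℕ) :
    ‖∑ k ∈ range K, u (N + k + h) - ∑ k ∈ range K, u (N + k)‖ ≤ 2 * h := by
  induction h with
  | zero => simp
  | succ h ih =>
    have key : ∑ k ∈ range K, u (N + k + (h + 1)) - ∑ k ∈ range K, u (N + k + h)
        = u (N + h + K) - u (N + h) := by
      rw [← sum_sub_distrib]
      have := sum_range_sub (fun k => u (N + h + k)) K
      rw [add_zero] at this
      rw [← this]
      refine sum_congr rfl fun k _ => ?_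
      congr 2 <;> omega
    have h2 : ‖u (N + h + K) - u (N + h)‖ ≤ 2 := by
      linarith [norm_sub_le (u (N + h + K)) (u (N + h)), hu (N + h + K), hu (N + h)]
    rw [← key] at h2
    push_cast
    linarith [norm_sub_le_norm_sub_add_norm_sub (∑ k ∈ range K, u (N + k + (h + 1)))
      (∑ k ∈ range K, u (N + k + h)) (∑ k ∈ range K, u (N + k))]

/-- A bounded sequence which is multiplied by a fixed `c ≠ 1` under a shift is uniformly
mean zero. -/
theorem UniformMeanZero.of_shift_eq_mul {u : ℕ → ℂ} (hu : ∀ n, ‖u n‖ ≤ 1) {q : ℕ} {c : ℂ}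
    (hc : c ≠ 1) (h : ∀ n, u (n + q) = c * u n) : UniformMeanZero u := by
  intro ε hε
  have hc' : 0 < ‖c - 1‖ := norm_pos_iff.2 (sub_ne_zero.2 hc)
  filter_upwards [eventually_ge_atTop ⌈2 * q / (‖c - 1‖ * ε)⌉₊] with K hK N
  have h1 := norm_sum_range_shift_sub_le hu q K N
  simp only [h] at h1
  rw [← mul_sum, ← sub_one_mul, norm_mul] at h1
  have h2 : 2 * q / (‖c - 1‖ * ε) ≤ K := Nat.ceil_le.1 hK
  rw [div_le_iff₀ (by positivity)] at h2
  refine le_of_mul_le_mul_left ?_ hc'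
  linarith

/-- The van der Corput difference theorem, uniformly in the starting point. -/
theorem UniformMeanZero.of_vanDerCorput {u : ℕ → ℂ} (hu : ∀ n, ‖u n‖ ≤ 1)
    (h : ∀ m : ℕ, 1 ≤ m → UniformMeanZero fun n => u (n + m) * conj (u n)) :
    UniformMeanZero u := by
  intro ε hε
  obtain ⟨H, hH⟩ := exists_nat_ge (8 / ε ^ 2 + 1)
  have hH1 : (1 : ℝ) ≤ H := le_trans (by linarith [show 0 ≤ 8 / ε ^ 2 by positivity]) hH
  have hH2 : 8 ≤ H * ε ^ 2 := by
    rw [← div_le_iff₀ (by positivity)]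
    linarith
  have corr : ∀ᶠ K : ℕ in atTop, ∀ i ∈ range H, ∀ j ∈ range H, ∀ N,
      i ≠ j → ‖∑ k ∈ range K, u (N + k + i) * conj (u (N + k + j))‖ ≤ 1 / H * K := by
    rw [Filter.eventually_all_finset]
    intro i _
    rw [Filter.eventually_all_finset]
    intro j _
    have hij : i ≠ j → UniformMeanZero fun n => u (n + i) * conj (u (n + j)) := by
      intro hne
      rcases lt_or_gt_of_ne hne with hlt | hlt
      · obtain ⟨m, rfl⟩ := Nat.exists_eq_add_of_lt hlt
        convert ((h (m + 1) (by omega)).comp_add i).map_conj using 2 with n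
        rw [map_mul, Complex.conj_conj, mul_comm]
        congr 3; omega
      · obtain ⟨m, rfl⟩ := Nat.exists_eq_add_of_lt hlt
        convert (h (m + 1) (by omega)).comp_add j using 3 with n
        congr 1; omega
    by_cases hne : i = j
    · exact Eventually.of_forall fun K N hn => absurd hne hn
    · filter_upwards [hij hne (1 / H) (by positivity)] with K hK N _
      exact hK N
  filter_upwards [corr, eventually_ge_atTop ⌈4 * H / ε⌉₊] with K hK hKH N
  have hKH' : 4 * H / ε ≤ K := Nat.ceil_le.1 hKH
  rw [div_le_iff₀ hε] at hKH'
  set S := ∑ k ∈ range K, u (N + k) with hS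
  set D := ∑ k ∈ range K, ∑ i ∈ range H, u (N + k + i) with hD
  have h1 : ‖D - H * S‖ ≤ H * (2 * H) := by
    have : D - H * S = ∑ i ∈ range H, (∑ k ∈ range K, u (N + k + i) - S) := by
      rw [sum_sub_distrib, hD, sum_comm]
      simp
    rw [this]
    refine (norm_sum_le_of_le _ (f := fun i => ∑ k ∈ range K, u (N + k + i) - S)
      (n := fun _ => 2 * (H : ℝ)) fun i hi => ?_).trans (by simp)
    refine (norm_sum_range_shift_sub_le hu i K N).trans ?_
    have : (i : ℝ) ≤ H := by exact_mod_cast (mem_range.1 hi).le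
    linarith
  have h2 : ∑ k ∈ range K, ‖∑ i ∈ range H, u (N + k + i)‖ ^ 2 ≤ 2 * H * K := by
    have e1 : ((∑ k ∈ range K, ‖∑ i ∈ range H, u (N + k + i)‖ ^ 2 : ℝ) : ℂ)
        = ∑ i ∈ range H, ∑ j ∈ range H,
            ∑ k ∈ range K, u (N + k + i) * conj (u (N + k + j)) := by
      push_cast
      simp_rw [← Complex.mul_conj', map_sum, sum_mul_sum]
      rw [sum_comm]
      exact sum_congr rfl fun i _ => sum_comm
    have e2 : ∀ i ∈ range H, ∀ j ∈ range H,
        ‖∑ k ∈ range K, u (N + k + i) * conj (u (N + k + j))‖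
          ≤ 1 / H * K + if i = j then (K : ℝ) else 0 := by
      intro i hi j hj
      split_ifs with hij
      · have : ‖∑ k ∈ range K, u (N + k + i) * conj (u (N + k + j))‖ ≤ K := by
          refine (norm_sum_le_of_le (n := fun _ => (1 : ℝ)) _ fun k _ => ?_).trans (by simp)
          rw [norm_mul, RCLike.norm_conj]
          exact mul_le_one₀ (hu _) (norm_nonneg _) (hu _)
        have : 0 ≤ 1 / (H : ℝ) * K := by positivity
        linarith
      · simpa using hK i hi j hj N hij
    have e3 : ‖((∑ k ∈ range K, ‖∑ i ∈ range H, u (N + k + i)‖ ^ 2 : ℝ) : ℂ)‖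
        ≤ ∑ i ∈ range H, ∑ j ∈ range H, (1 / H * K + if i = j then (K : ℝ) else 0) := by
      rw [e1]
      exact norm_sum_le_of_le _ fun i hi => norm_sum_le_of_le _ fun j hj => e2 i hi j hj
    have e4 : ∑ i ∈ range H, ∑ j ∈ range H, (1 / H * K + if i = j then (K : ℝ) else 0)
        = 2 * H * K := by
      have : ∀ i ∈ range H, ∑ j ∈ range H, (1 / H * K + if i = j then (K : ℝ) else 0)
          = 2 * K := by
        intro i hi
        rw [sum_add_distrib, sum_ite_eq, if_pos hi]
        simp only [sum_const, card_range, nsmul_eq_mul]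
        field_simp
        ring
      rw [sum_congr rfl this]
      simp only [sum_const, card_range, nsmul_eq_mul]
      ring
    rw [e4, Complex.norm_real] at e3
    exact (le_abs_self _).trans e3
  have h3 : ‖D‖ ≤ ε * H * K / 2 := by
    refine abs_le_of_sq_le_sq' ?_ (by positivity) |>.2
    calc ‖D‖ ^ 2 ≤ (∑ k ∈ range K, ‖∑ i ∈ range H, u (N + k + i)‖) ^ 2 := by
          gcongr
          exact norm_sum_le _ _
      _ ≤ K * ∑ k ∈ range K, ‖∑ i ∈ range H, u (N + k + i)‖ ^ 2 := by
          simpa using sq_sum_le_card_mul_sum_sq (s := range K)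
            (f := fun k => ‖∑ i ∈ range H, u (N + k + i)‖)
      _ ≤ K * (2 * H * K) := by gcongr
      _ = 8 * (H * K ^ 2 / 4) := by ring
      _ ≤ (H * ε ^ 2) * (H * K ^ 2 / 4) := by gcongr
      _ = (ε * H * K / 2) ^ 2 := by ring
  have h4 : ‖(H : ℂ) * S‖ ≤ ‖D‖ + ‖D - H * S‖ := by
    simpa [sub_sub_cancel] using norm_sub_le D (D - H * S)
  rw [norm_mul, Complex.norm_natCast] at h4
  refine le_of_mul_le_mul_left ?_ (show (0 : ℝ) < H by linarith)
  nlinarith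

open Polynomial in
theorem coeff_taylor_mem_of_coeff_mem {R : Type*} [CommRing R] (S : Subring R) {f : R[X]} {m : ℕ}
    (hf : ∀ j, m < j → f.coeff j ∈ S) {r : R} (hr : r ∈ S) :
    (taylor r f).coeff m - f.coeff m ∈ S := by
  rw [taylor_coeff, eval_eq_sum_range, sum_range_succ']
  simp only [hasseDeriv_coeff, zero_add, Nat.choose_self, Nat.cast_one, one_mul, pow_zero, mul_one,
    add_sub_cancel_right]
  exact S.sum_mem fun j _ => S.mul_mem (S.mul_mem (natCast_mem _ _) (hf _ (by omega)))
    (S.pow_mem hr _)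

open Polynomial in
theorem coeff_taylor_sub_mem_of_coeff_mem {R : Type*} [CommRing R] (S : Subring R) {f : R[X]}
    {m : ℕ} (hf : ∀ j, m + 1 < j → f.coeff j ∈ S) {r : R} (hr : r ∈ S) :
    (taylor r f).coeff m - f.coeff m - (m + 1) * f.coeff (m + 1) * r ∈ S := by
  have key := coeff_taylor_mem_of_coeff_mem S
    (f := f - monomial (m + 1) (f.coeff (m + 1))) (m := m) (fun j hj => by
      rcases eq_or_ne j (m + 1) with rfl | hne
      · simp [S.zero_mem]
      · rw [coeff_sub, coeff_monomial_of_ne _ hne, sub_zero]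
        exact hf j (by omega)) hr
  convert key using 1
  rw [map_sub, coeff_sub, coeff_sub, coeff_monomial_of_ne _ (by omega : m ≠ m + 1),
    taylor_coeff (f := monomial _ _), hasseDeriv_monomial, eval_monomial]
  simp
  ring

/-- A polynomial with rational coefficients is periodic modulo one on the natural numbers. -/
theorem exists_period_of_rational_coeff (r : Polynomial ℝ)
    (hr : ∀ j, r.coeff j ∈ (algebraMap ℚ ℝ).range) :
    ∃ q : ℕ, 1 ≤ q ∧ ∀ n : ℕ, ∃ z : ℤ, r.eval ((n + q : ℕ) : ℝ) - r.eval (n : ℝ) = z := by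
  choose c hc using hr
  refine ⟨∏ j ∈ range (r.natDegree + 1), (c j).den, Nat.one_le_iff_ne_zero.2
    (prod_ne_zero_iff.2 fun j _ => (c j).den_nz), fun n => ?_⟩
  set q := ∏ j ∈ range (r.natDegree + 1), (c j).den with hq
  suffices r.eval ((n + q : ℕ) : ℝ) - r.eval (n : ℝ) ∈ (Int.castRingHom ℝ).range by
    obtain ⟨z, hz⟩ := this
    exact ⟨z, hz.symm⟩
  rw [Polynomial.eval_eq_sum_range, Polynomial.eval_eq_sum_range, ← sum_sub_distrib]
  refine Subring.sum_mem _ fun j hj => ?_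
  obtain ⟨d, hd⟩ : (c j).den ∣ q := dvd_prod_of_mem (fun j => (c j).den) hj
  obtain ⟨t, ht⟩ : (q : ℤ) ∣ ((n + q : ℕ) : ℤ) ^ j - (n : ℤ) ^ j := by
    have := sub_dvd_pow_sub_pow ((n + q : ℕ) : ℤ) (n : ℤ) j
    simpa using this
  refine ⟨(c j).num * d * t, ?_⟩
  have ht' : ((n + q : ℕ) : ℝ) ^ j - (n : ℝ) ^ j = q * t := by exact_mod_cast ht
  have hd' : (q : ℝ) = (c j).den * d := by exact_mod_cast hd
  have hcj : r.coeff j = (c j).num / (c j).den := by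
    rw [← hc j]
    exact Rat.cast_def (c j)
  have hne : ((c j).den : ℝ) ≠ 0 := by exact_mod_cast (c j).den_nz
  rw [← mul_sub, ht', hd', hcj]
  simp only [eq_intCast]
  push_cast
  field_simp

theorem norm_exp_two_pi_mul_I (x : ℝ) : ‖Complex.exp (2 * Real.pi * Complex.I * x)‖ = 1 := by
  rw [show (2 * Real.pi * Complex.I * x : ℂ) = ((2 * Real.pi * x : ℝ) : ℂ) * Complex.I by
    push_cast; ring]
  exact Complex.norm_exp_ofReal_mul_I _

theorem exp_two_pi_mul_I_intCast (z : ℤ) : Complex.exp (2 * Real.pi * Complex.I * z) = 1 :=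
  Complex.exp_eq_one_iff.2 ⟨z, by ring⟩

theorem mem_range_ratCast_iff_not_irrational {x : ℝ} :
    x ∈ (algebraMap ℚ ℝ).range ↔ ¬ Irrational x := by
  simp [Irrational]

theorem uniformMeanZero_exp_of_linear_irrational (f : Polynomial ℝ)
    (h1 : Irrational (f.coeff 1)) (hf : ∀ j, 1 < j → f.coeff j ∈ (algebraMap ℚ ℝ).range) :
    UniformMeanZero fun n => Complex.exp (2 * Real.pi * Complex.I * (f.eval (n : ℝ) : ℝ)) := by
  set r := f - Polynomial.C (f.coeff 0) - Polynomial.C (f.coeff 1) * Polynomial.X with hr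
  obtain ⟨q, hq1, hq⟩ := exists_period_of_rational_coeff r (fun j => by
    rcases j with _ | _ | j
    · simp [hr]
    · simp [hr, Polynomial.coeff_C]
    · simpa [hr, Polynomial.coeff_C, Polynomial.coeff_X] using hf (j + 2) (by omega))
  refine UniformMeanZero.of_shift_eq_mul (q := q)
    (c := Complex.exp (2 * Real.pi * Complex.I * (f.coeff 1 * q : ℝ)))
    (fun n => (norm_exp_two_pi_mul_I _).le) ?_ fun n => ?_
  · intro h
    obtain ⟨z, hz⟩ := Complex.exp_eq_one_iff.1 h
    have hz' : f.coeff 1 * q = z := by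
      have h2 : (2 * Real.pi * Complex.I : ℂ) ≠ 0 := Complex.two_pi_I_ne_zero
      rw [mul_comm (z : ℂ)] at hz
      exact_mod_cast mul_left_cancel₀ h2 hz
    exact (h1.mul_natCast (by omega : q ≠ 0)).ne_int z hz'
  · obtain ⟨z, hz⟩ := hq n
    have : f.eval ((n + q : ℕ) : ℝ) = f.coeff 1 * q + f.eval (n : ℝ) + z := by
      rw [← hz, hr]
      simp
      ring
    rw [this]
    push_cast
    rw [mul_add, mul_add, Complex.exp_add, Complex.exp_add, exp_two_pi_mul_I_intCast, mul_one]

/-- The uniform Weyl theorem, with `m` the largest degree of an irrational coefficient. -/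
theorem uniformMeanZero_exp_of_top_irrational (m : ℕ) (f : Polynomial ℝ)
    (hm : Irrational (f.coeff (m + 1)))
    (hf : ∀ j, m + 1 < j → f.coeff j ∈ (algebraMap ℚ ℝ).range) :
    UniformMeanZero fun n => Complex.exp (2 * Real.pi * Complex.I * (f.eval (n : ℝ) : ℝ)) := by
  induction m generalizing f with
  | zero => exact uniformMeanZero_exp_of_linear_irrational f hm hf
  | succ m ih =>
    refine UniformMeanZero.of_vanDerCorput (fun n => (norm_exp_two_pi_mul_I _).le) fun k hk => ?_
    convert ih (Polynomial.taylor (k : ℝ) f - f) ?_ ?_ using 2 with n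
    · rw [← Complex.exp_conj, ← Complex.exp_add, Polynomial.eval_sub, Polynomial.taylor_eval]
      congr 1
      simp only [map_mul, Complex.conj_I, Complex.conj_ofReal, map_ofNat]
      push_cast
      ring
    · have key := coeff_taylor_sub_mem_of_coeff_mem (algebraMap ℚ ℝ).range hf
        (natCast_mem _ k : (k : ℝ) ∈ (algebraMap ℚ ℝ).range)
      rw [Polynomial.coeff_sub]
      by_contra hrat
      rw [← mem_range_ratCast_iff_not_irrational] at hrat
      have h2 := Subring.sub_mem _ hrat key
      rw [sub_sub_cancel, mem_range_ratCast_iff_not_irrational] at h2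
      refine h2 ?_
      have := (hm.natCast_mul (m := m + 1 + 1) (by omega)).mul_natCast (m := k) (by omega)
      exact_mod_cast this
    · intro j hj
      rcases eq_or_lt_of_le (Nat.succ_le_of_lt hj) with rfl | hj'
      · rw [Polynomial.coeff_sub]
        exact coeff_taylor_mem_of_coeff_mem _ hf (natCast_mem _ k)
      · rw [Polynomial.coeff_sub]
        exact coeff_taylor_mem_of_coeff_mem _ (fun i hi => hf i (by omega)) (natCast_mem _ k)

/-- Weyl's theorem on polynomial exponential sums, uniformly in the starting point. -/
theorem uniformMeanZero_exp_of_irrational (f : Polynomial ℝ)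
    (hf : ∃ m : ℕ, m ≠ 0 ∧ Irrational (f.coeff m)) :
    UniformMeanZero fun n => Complex.exp (2 * Real.pi * Complex.I * (f.eval (n : ℝ) : ℝ)) := by
  classical
  obtain ⟨m₀, hm₀, hirr⟩ := hf
  have hbound : ∀ j, Irrational (f.coeff j) → j ≤ f.natDegree := fun j hj =>
    Polynomial.le_natDegree_of_ne_zero hj.ne_zero
  set M := Nat.findGreatest (fun j => Irrational (f.coeff j)) f.natDegree with hM
  have hM1 : Irrational (f.coeff M) :=
    Nat.findGreatest_spec (P := fun j => Irrational (f.coeff j)) (hbound m₀ hirr) hirr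
  have hM2 : m₀ ≤ M :=
    Nat.le_findGreatest (P := fun j => Irrational (f.coeff j)) (hbound m₀ hirr) hirr
  obtain ⟨m, hm⟩ := Nat.exists_eq_succ_of_ne_zero (by omega : M ≠ 0)
  refine uniformMeanZero_exp_of_top_irrational m f (by rwa [hm] at hM1) fun j hj => ?_
  rw [mem_range_ratCast_iff_not_irrational]
  intro hj'
  have : j ≤ M := Nat.le_findGreatest (P := fun j => Irrational (f.coeff j)) (hbound j hj') hj'
  omega

open MeasureTheory in
theorem integral_fourier_eq_zero {n : ℤ} (hn : n ≠ 0) :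
    ∫ x : UnitAddCircle, fourier n x ∂AddCircle.haarAddCircle = 0 :=
  integral_eq_zero_of_add_right_eq_neg
    (fun x => fourier_add_half_inv_index hn one_pos x)

/-- The normalised Haar measure on the torus, as a product measure. -/
noncomputable abbrev torusMeasure (s : ℕ) : MeasureTheory.Measure (UnitAddTorus (Fin s)) :=
  MeasureTheory.Measure.pi fun _ => AddCircle.haarAddCircle

theorem integral_mFourier_eq_zero {s : ℕ} {h : Fin s → ℤ} (hh : h ≠ 0) :
    ∫ x, UnitAddTorus.mFourier h x ∂torusMeasure s = 0 := by
  obtain ⟨i, hi⟩ := Function.ne_iff.1 hh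
  have := MeasureTheory.integral_fintype_prod_eq_prod (𝕜 := ℂ)
    (μ := fun _ : Fin s => (AddCircle.haarAddCircle : MeasureTheory.Measure UnitAddCircle))
    (fun i x => fourier (h i) x)
  refine this.trans (prod_eq_zero (mem_univ i) (integral_fourier_eq_zero hi))

/-- A Weyl criterion for uniform distribution with respect to all starting points. -/
theorem uniformMeanZero_sub_integral {s : ℕ} (x : ℕ → UnitAddTorus (Fin s))
    (hx : ∀ h : Fin s → ℤ, h ≠ 0 → UniformMeanZero fun n => UnitAddTorus.mFourier h (x n))
    (F : C(UnitAddTorus (Fin s), ℂ)) :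
    UniformMeanZero fun n => F (x n) - ∫ y, F y ∂torusMeasure s := by
  have hint : ∀ G : C(UnitAddTorus (Fin s), ℂ), MeasureTheory.Integrable G (torusMeasure s) :=
    fun G => G.continuous.integrable_of_hasCompactSupport (HasCompactSupport.of_compactSpace _)
  have hspan : ∀ G ∈ Submodule.span ℂ (Set.range (UnitAddTorus.mFourier (d := Fin s))),
      UniformMeanZero fun n => G (x n) - ∫ y, G y ∂torusMeasure s := by
    intro G hG
    induction hG using Submodule.span_induction with
    | mem G hG =>
      obtain ⟨h, rfl⟩ := hG
      rcases eq_or_ne h 0 with rfl | hh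
      · refine UniformMeanZero.of_eq_zero fun n => ?_
        simp [UnitAddTorus.mFourier_zero]
      · simpa only [integral_mFourier_eq_zero hh, sub_zero] using hx h hh
    | zero => exact UniformMeanZero.of_eq_zero fun n => by simp
    | add G₁ G₂ _ _ h₁ h₂ =>
      convert h₁.add h₂ using 2 with n
      simp only [ContinuousMap.add_apply]
      rw [MeasureTheory.integral_add (hint G₁) (hint G₂)]
      ring
    | smul c G _ hG =>
      convert hG.const_mul c using 2 with n
      simp only [ContinuousMap.smul_apply, smul_eq_mul]
      rw [MeasureTheory.integral_const_mul]
      ring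
  refine UniformMeanZero.of_approx fun ε hε => ?_
  have hF : F ∈ closure
      (Submodule.span ℂ (Set.range (UnitAddTorus.mFourier (d := Fin s))) : Set _) := by
    rw [← Submodule.topologicalClosure_coe, UnitAddTorus.span_mFourier_closure_eq_top]
    trivial
  obtain ⟨G, hG, hFG⟩ := Metric.mem_closure_iff.1 hF (ε / 2) (by positivity)
  refine ⟨_, hspan G hG, fun n => ?_⟩
  have hpt : ∀ y, ‖F y - G y‖ ≤ ε / 2 := fun y => by
    rw [← dist_eq_norm]
    exact (ContinuousMap.dist_apply_le_dist y).trans hFG.le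
  have hI : ‖(∫ y, F y ∂torusMeasure s) - ∫ y, G y ∂torusMeasure s‖ ≤ ε / 2 := by
    rw [← MeasureTheory.integral_sub (hint F) (hint G)]
    simpa using MeasureTheory.norm_integral_le_of_norm_le_const
      (μ := torusMeasure s) (Eventually.of_forall hpt)
  rw [sub_sub_sub_comm]
  refine (norm_sub_le _ _).trans ?_
  linarith [hpt (x n)]

/-- Under the Weyl criterion, visits to a nonempty open set have bounded gaps. -/
theorem eventually_exists_mem_of_isOpen {s : ℕ} (x : ℕ → UnitAddTorus (Fin s))
    (hx : ∀ h : Fin s → ℤ, h ≠ 0 → UniformMeanZero fun n => UnitAddTorus.mFourier h (x n))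
    {U : Set (UnitAddTorus (Fin s))} (hU : IsOpen U) (hne : U.Nonempty) :
    ∀ᶠ K : ℕ in atTop, ∀ N : ℕ, ∃ k < K, x (N + k) ∈ U := by
  obtain ⟨y, hy⟩ := hne
  obtain ⟨F, hF0, hF1, hF⟩ := exists_continuous_zero_one_of_isClosed hU.isClosed_compl
    (isClosed_singleton (x := y)) (Set.disjoint_singleton_right.2 fun h => h hy)
  have hpos : 0 < ∫ t, F t ∂torusMeasure s :=
    F.continuous.integral_pos_of_hasCompactSupport_nonneg_nonzero
      (HasCompactSupport.of_compactSpace _) (fun t => (hF t).1) (x := y)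
      (by rw [hF1 rfl]; exact one_ne_zero)
  set c := ∫ t, F t ∂torusMeasure s with hc
  have key := uniformMeanZero_sub_integral x hx
    ⟨fun t => (F t : ℂ), Complex.continuous_ofReal.comp F.continuous⟩
  simp only [ContinuousMap.coe_mk, integral_complex_ofReal, ← hc] at key
  filter_upwards [key (c / 2) (by positivity), eventually_ge_atTop 1] with K hK hK1 N
  by_contra! hcon
  have hsum : ∑ k ∈ range K, ((F (x (N + k)) : ℂ) - c) = -(K * c) := by
    rw [sum_congr rfl fun k hk => by rw [hF0 (hcon k (mem_range.1 hk))]]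
    simp
  have h1 := hK N
  rw [hsum, norm_neg, norm_mul, Complex.norm_natCast, Complex.norm_real, Real.norm_eq_abs,
    abs_of_pos hpos] at h1
  have h2 : (1 : ℝ) ≤ K := by exact_mod_cast hK1
  nlinarith

theorem fract_mem_Ioo_of_coe_mem_image {a b t : ℝ} (ha : 0 ≤ a) (hb : b ≤ 1)
    (h : (t : UnitAddCircle) ∈ (fun y : ℝ => (y : UnitAddCircle)) '' Set.Ioo a b) :
    Int.fract t ∈ Set.Ioo a b := by
  obtain ⟨y, hy, hyt⟩ := h
  obtain ⟨n, hn⟩ := AddCircle.coe_eq_zero_iff (p := (1 : ℝ)) |>.1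
    (show ((t - y : ℝ) : UnitAddCircle) = 0 by rw [AddCircle.coe_sub, ← hyt, sub_self])
  have : t = y + n := by
    simp only [zsmul_eq_mul, mul_one] at hn
    linarith
  rwa [this, Int.fract_add_intCast,
    Int.fract_eq_self.2 ⟨ha.trans hy.1.le, hy.2.trans_le hb⟩]

theorem mFourier_coe_eval {s : ℕ} (p : Fin s → Polynomial ℝ) (h : Fin s → ℤ) (t : ℝ) :
    UnitAddTorus.mFourier h (fun i => (((p i).eval t : ℝ) : UnitAddCircle))
      = Complex.exp (2 * Real.pi * Complex.I *
        ((∑ i : Fin s, Polynomial.C ((h i : ℝ)) * p i).eval t : ℝ)) := by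
  simp only [UnitAddTorus.mFourier, ContinuousMap.coe_mk, fourier_coe_apply,
    Polynomial.eval_finsetSum, Polynomial.eval_mul, Polynomial.eval_C]
  rw [← Complex.exp_sum]
  push_cast
  rw [mul_sum]
  congr 1
  refine sum_congr rfl fun i _ => ?_
  ring

theorem eventually_exists_fract_eval_mem_Ioo {s : ℕ} (p : Fin s → Polynomial ℝ)
    (hp : ∀ h : Fin s → ℤ, h ≠ 0 →
      ∃ m : ℕ, m ≠ 0 ∧ Irrational ((∑ i : Fin s, Polynomial.C ((h i : ℝ)) * p i).coeff m))
    (a b : Fin s → ℝ) (hab : ∀ i : Fin s, 0 ≤ a i ∧ a i < b i ∧ b i ≤ 1) :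
    ∀ᶠ K : ℕ in atTop, ∀ N : ℕ, ∃ k < K,
      ∀ i : Fin s, Int.fract ((p i).eval ((N + k : ℕ) : ℝ)) ∈ Set.Ioo (a i) (b i) := by
  have hopen : IsOpen (Set.univ.pi fun i : Fin s =>
      (fun y : ℝ => (y : UnitAddCircle)) '' Set.Ioo (a i) (b i)) :=
    isOpen_set_pi Set.finite_univ fun i _ => QuotientAddGroup.isOpenMap_coe _ isOpen_Ioo
  have hne : (Set.univ.pi fun i : Fin s =>
      (fun y : ℝ => (y : UnitAddCircle)) '' Set.Ioo (a i) (b i)).Nonempty :=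
    Set.univ_pi_nonempty_iff.2 fun i => (Set.nonempty_Ioo.2 (hab i).2.1).image _
  have hx : ∀ h : Fin s → ℤ, h ≠ 0 → UniformMeanZero fun n : ℕ =>
      UnitAddTorus.mFourier h (fun i => (((p i).eval (n : ℝ) : ℝ) : UnitAddCircle)) := by
    intro h hh
    simp only [mFourier_coe_eval]
    exact uniformMeanZero_exp_of_irrational _ (hp h hh)
  filter_upwards [eventually_exists_mem_of_isOpen _ hx hopen hne] with K hK N
  obtain ⟨k, hk, hmem⟩ := hK N
  exact ⟨k, hk, fun i => fract_mem_Ioo_of_coe_mem_image (hab i).1 (hab i).2.2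
    (hmem i (Set.mem_univ i))⟩

theorem exists_Ioo_disjoint_Ico {a b : ℝ} (ha : 0 ≤ a) (hb : b ≤ 1) (h : ¬ (a = 0 ∧ b = 1)) :
    ∃ c d : ℝ, 0 ≤ c ∧ c < d ∧ d ≤ 1 ∧ Disjoint (Set.Ioo c d) (Set.Ico a b) := by
  rcases ha.eq_or_lt with rfl | ha'
  · have hb' : b < 1 := hb.lt_of_ne fun hb1 => h ⟨rfl, hb1⟩
    refine ⟨max 0 b, 1, le_max_left _ _, max_lt one_pos hb', le_rfl, ?_⟩
    rw [Set.disjoint_left]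
    exact fun t ht ht' => ht'.2.not_gt ((le_max_right _ _).trans_lt ht.1)
  · refine ⟨0, min a 1, le_rfl, lt_min ha' one_pos, min_le_right _ _, ?_⟩
    rw [Set.disjoint_left]
    exact fun t ht ht' => ht'.1.not_gt (ht.2.trans_le (min_le_left _ _))

end

/-- if `p = (p⁽¹⁾, …, p⁽ˢ⁾)` is a tuple of real polynomials such that for
every nonzero lattice point `h ∈ ℤ^s` the polynomial `⟨h, p⟩` has at least one
non-constant monomial with irrational coefficient, then the sequence of componentwise
fractional parts `({p(n)})_{n ≥ 1}` in `[0,1)^s` has no `s`-dimensional S-NBRS: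
for every proper box `[a₁,b₁) × ⋯ × [aₛ,bₛ) ⊊ [0,1)^s` of positive volume there is a
`K` such that among any `K` successive elements at least one lies in the box and at
least one lies outside. -/
theorem polynomial_no_snbrs (s : ℕ) (p : Fin s → Polynomial ℝ)
    (hp : ∀ h : Fin s → ℤ, h ≠ 0 →
      ∃ m : ℕ, m ≠ 0 ∧ Irrational ((∑ i : Fin s, Polynomial.C ((h i : ℝ)) * p i).coeff m))
    (a b : Fin s → ℝ) (hab : ∀ i : Fin s, 0 ≤ a i ∧ a i < b i ∧ b i ≤ 1)
    (hproper : ¬ ∀ i : Fin s, a i = 0 ∧ b i = 1) :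
    ∃ K : ℕ, 1 ≤ K ∧ ∀ N : ℕ,
      (∃ k : ℕ, 1 ≤ k ∧ k ≤ K ∧
        ∀ i : Fin s, Int.fract ((p i).eval ((N + k : ℕ) : ℝ)) ∈ Set.Ico (a i) (b i)) ∧
      (∃ k : ℕ, 1 ≤ k ∧ k ≤ K ∧
        ¬ ∀ i : Fin s, Int.fract ((p i).eval ((N + k : ℕ) : ℝ)) ∈ Set.Ico (a i) (b i)) := by
  obtain ⟨i₀, hi₀⟩ := not_forall.1 hproper
  obtain ⟨c, d, hc, hcd, hd, hdisj⟩ := exists_Ioo_disjoint_Ico (hab i₀).1 (hab i₀).2.2 hi₀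
  have hcd' : ∀ i : Fin s, 0 ≤ Function.update (0 : Fin s → ℝ) i₀ c i ∧
      Function.update (0 : Fin s → ℝ) i₀ c i < Function.update (1 : Fin s → ℝ) i₀ d i ∧
      Function.update (1 : Fin s → ℝ) i₀ d i ≤ 1 := by
    intro i
    rcases eq_or_ne i i₀ with rfl | hne
    · simp [hc, hcd, hd]
    · simp [hne]
  obtain ⟨K, hin, hout, hK⟩ := ((eventually_exists_fract_eval_mem_Ioo p hp a b hab).and
    ((eventually_exists_fract_eval_mem_Ioo p hp _ _ hcd').and
      (Filter.eventually_ge_atTop 1))).exists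
  refine ⟨K, hK, fun N => ⟨?_, ?_⟩⟩
  · obtain ⟨k, hk, hmem⟩ := hin (N + 1)
    refine ⟨k + 1, by omega, by omega, fun i => ?_⟩
    rw [show N + (k + 1) = N + 1 + k by omega]
    exact Set.Ioo_subset_Ico_self (hmem i)
  · obtain ⟨k, hk, hmem⟩ := hout (N + 1)
    refine ⟨k + 1, by omega, by omega, fun hall => ?_⟩
    have h1 := hmem i₀
    have h2 := hall i₀
    rw [Function.update_self, Function.update_self] at h1
    rw [show N + (k + 1) = N + 1 + k by omega] at h2
    exact Set.disjoint_left.1 hdisj h1 h2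
end

section
/- Let q ∈ ℕ and let α_1, α_2, …, α_q be irrational numbers such that 1, α_1, …, α_q are linearly independent over ℚ. Let (x_n)_{n≥1} = ({n α_1}, {n α_2}, …, {n α_q})_{n≥1} in [0,1)^q. Then for every box [0,b) = [0,b_1) × [0,b_2) × ⋯ × [0,b_q) ⊂ [0,1)^q of positive volume there exists K ∈ ℕ such that among any K consecutive elements x_{N+1}, …, x_{N+K} at least one is contained in [0,b). -/
open MeasureTheory Set Submodule

namespace UnitAddTorus

variable {d : Type*} [Fintype d]

lemma mFourier_apply_add (h : d → ℤ) (x y : UnitAddTorus d) :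
    mFourier h (x + y) = mFourier h x * mFourier h y := by
  simp only [mFourier, ContinuousMap.coe_mk, Pi.add_apply, fourier_apply, smul_add,
    AddCircle.toCircle_add, Circle.coe_mul, Finset.prod_mul_distrib]

lemma norm_mFourier_apply (h : d → ℤ) (x : UnitAddTorus d) : ‖mFourier h x‖ = 1 := by
  simp only [mFourier, ContinuousMap.coe_mk, fourier_apply, norm_prod, Circle.norm_coe,
    Finset.prod_const_one]

lemma mFourier_apply_nsmul (h : d → ℤ) (x : UnitAddTorus d) (k : ℕ) :
    mFourier h (k • x) = mFourier h x ^ k := by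
  induction k with
  | zero => simp [mFourier]
  | succ k ih => rw [succ_nsmul, mFourier_apply_add, ih, pow_succ]

lemma mFourier_apply_coe (h : d → ℤ) (α : d → ℝ) :
    mFourier h (fun i ↦ (α i : UnitAddCircle)) =
      Complex.exp ((∑ i, h i * α i : ℝ) * (2 * Real.pi * Complex.I)) := by
  simp only [mFourier, ContinuousMap.coe_mk, fourier_coe_apply, ← Complex.exp_sum]
  push_cast
  rw [Finset.sum_mul]
  congr 1
  exact Finset.sum_congr rfl fun i _ ↦ by ring

/-- A translation-invariant measure annihilates every monomial that is nontrivial at some point. -/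
lemma integral_mFourier_eq_zero (μ : Measure (UnitAddTorus d)) [μ.IsAddRightInvariant]
    {h : d → ℤ} {a : UnitAddTorus d} (ha : mFourier h a ≠ 1) :
    ∫ x, mFourier h x ∂μ = 0 := by
  have key : ∫ x, mFourier h (x + a) ∂μ = ∫ x, mFourier h x ∂μ :=
    integral_add_right_eq_self (fun x ↦ mFourier h x) a
  simp_rw [mFourier_apply_add] at key
  rw [integral_mul_const] at key
  by_contra h0
  exact ha (mul_left_cancel₀ h0 (key.trans (mul_one _).symm))

/-- If no nontrivial monomial takes the value `1` at `a`, then the averages of a continuous function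
along the orbits of translation by `a` converge to its mean, uniformly in the starting point. -/
theorem exists_forall_norm_sum_sub_integral_le (μ : Measure (UnitAddTorus d))
    [IsProbabilityMeasure μ] [μ.IsAddRightInvariant] {a : UnitAddTorus d}
    (ha : ∀ h : d → ℤ, h ≠ 0 → mFourier h a ≠ 1) (f : C(UnitAddTorus d, ℂ)) {ε : ℝ} (hε : 0 < ε) :
    ∃ K₀ : ℕ, ∀ K ≥ K₀, ∀ x : UnitAddTorus d,
      ‖∑ k ∈ Finset.range K, f (x + k • a) - K * ∫ y, f y ∂μ‖ ≤ ε * K := by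
  have integrable (g : C(UnitAddTorus d, ℂ)) : Integrable g μ :=
    g.continuous.integrable_of_hasCompactSupport (HasCompactSupport.of_compactSpace g)
  -- for trigonometric polynomials the deviation is even bounded
  have bounded : ∀ g ∈ span ℂ (range (mFourier (d := d))), ∃ C : ℝ, ∀ (K : ℕ) x,
      ‖∑ k ∈ Finset.range K, g (x + k • a) - K * ∫ y, g y ∂μ‖ ≤ C := by
    intro g hg
    induction hg using span_induction with
    | mem g hg =>
      obtain ⟨h, rfl⟩ := hg
      by_cases h0 : h = 0
      · subst h0
        exact ⟨0, fun K x ↦ by simp [mFourier_zero]⟩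
      · refine ⟨2 / ‖mFourier h a - 1‖, fun K x ↦ ?_⟩
        rw [integral_mFourier_eq_zero μ (ha h h0), mul_zero, sub_zero]
        simp_rw [mFourier_apply_add, mFourier_apply_nsmul]
        rw [← Finset.mul_sum, geom_sum_eq (ha h h0), norm_mul, norm_mFourier_apply, one_mul,
          norm_div]
        gcongr
        refine (norm_sub_le _ _).trans ?_
        rw [norm_pow, norm_mFourier_apply, one_pow, norm_one]
        norm_num
    | zero => exact ⟨0, fun K x ↦ by simp⟩
    | add g₁ g₂ _ _ h₁ h₂ =>
      obtain ⟨C₁, h₁⟩ := h₁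
      obtain ⟨C₂, h₂⟩ := h₂
      refine ⟨C₁ + C₂, fun K x ↦ ?_⟩
      refine le_trans (le_of_eq ?_) ((norm_add_le _ _).trans (add_le_add (h₁ K x) (h₂ K x)))
      simp only [ContinuousMap.add_apply]
      rw [integral_add (integrable g₁) (integrable g₂), Finset.sum_add_distrib]
      congr 1
      ring
    | smul c g _ hg =>
      obtain ⟨C, hC⟩ := hg
      refine ⟨‖c‖ * C, fun K x ↦ ?_⟩
      refine le_trans (le_of_eq ?_) (mul_le_mul_of_nonneg_left (hC K x) (norm_nonneg c))
      simp only [ContinuousMap.smul_apply, smul_eq_mul]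
      rw [integral_const_mul, ← Finset.mul_sum, ← norm_mul]
      congr 1
      ring
  have hf : f ∈ closure (span ℂ (range (mFourier (d := d))) : Set C(UnitAddTorus d, ℂ)) := by
    rw [← Submodule.topologicalClosure_coe, span_mFourier_closure_eq_top]
    trivial
  obtain ⟨g, hg, hfg⟩ := Metric.mem_closure_iff.1 hf (ε / 3) (by positivity)
  rw [dist_eq_norm] at hfg
  have hpt (y : UnitAddTorus d) : ‖f y - g y‖ ≤ ε / 3 :=
    ((f - g).norm_coe_le_norm y).trans hfg.le
  obtain ⟨C, hC⟩ := bounded g hg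
  obtain ⟨K₀, hK₀⟩ := exists_nat_ge (C / (ε / 3))
  refine ⟨K₀, fun K hK x ↦ ?_⟩
  have hCK : C ≤ ε / 3 * K := by
    rw [div_le_iff₀' (by positivity)] at hK₀
    exact hK₀.trans (by gcongr)
  have hsum : ‖∑ k ∈ Finset.range K, (f (x + k • a) - g (x + k • a))‖ ≤ ε / 3 * K := by
    refine (norm_sum_le_of_le _ fun k _ ↦ hpt _).trans (le_of_eq ?_)
    simp [mul_comm]
  have hint : ‖∫ y, (f y - g y) ∂μ‖ ≤ ε / 3 := by
    simpa using norm_integral_le_of_norm_le_const (μ := μ) (Filter.Eventually.of_forall hpt)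
  rw [Finset.sum_sub_distrib] at hsum
  rw [integral_sub (integrable f) (integrable g)] at hint
  have hint' : ‖(K : ℂ) * (∫ y, f y ∂μ - ∫ y, g y ∂μ)‖ ≤ ε / 3 * K := by
    rw [norm_mul, Complex.norm_natCast, mul_comm]
    gcongr
  calc _ = ‖(∑ k ∈ Finset.range K, f (x + k • a) - ∑ k ∈ Finset.range K, g (x + k • a))
          + (∑ k ∈ Finset.range K, g (x + k • a) - K * ∫ y, g y ∂μ)
          - K * (∫ y, f y ∂μ - ∫ y, g y ∂μ)‖ := by congr 1; ring
    _ ≤ ε / 3 * K + ε / 3 * K + ε / 3 * K :=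
        (norm_sub_le _ _).trans (add_le_add ((norm_add_le _ _).trans
          (add_le_add hsum ((hC K x).trans hCK))) hint')
    _ = ε * K := by ring

/-- If no nontrivial monomial takes the value `1` at `a`, then translation by `a` returns to any
nonempty open set within a bounded number of steps, uniformly in the starting point. -/
theorem exists_forall_exists_add_nsmul_mem {a : UnitAddTorus d}
    (ha : ∀ h : d → ℤ, h ≠ 0 → mFourier h a ≠ 1) {U : Set (UnitAddTorus d)} (hU : IsOpen U)
    (hne : U.Nonempty) : ∃ K : ℕ, ∀ x : UnitAddTorus d, ∃ k < K, x + k • a ∈ U := by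
  let μ : Measure (UnitAddTorus d) := Measure.addHaarMeasure ⊤
  have : IsProbabilityMeasure μ := ⟨Measure.addHaarMeasure_self⟩
  obtain ⟨c, hc⟩ := hne
  obtain ⟨f, hf0, hf1, hf⟩ := exists_continuous_zero_one_of_isClosed hU.isClosed_compl
    (isClosed_singleton (x := c)) (by simpa using hc)
  have hpos : 0 < ∫ x, f x ∂μ :=
    f.continuous.integral_pos_of_hasCompactSupport_nonneg_nonzero
      (HasCompactSupport.of_compactSpace f) (fun x ↦ (hf x).1) (x := c) (by simp [hf1 rfl])
  let F : C(UnitAddTorus d, ℂ) := ⟨fun x ↦ (f x : ℂ), by fun_prop⟩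
  obtain ⟨K₀, hK₀⟩ := exists_forall_norm_sum_sub_integral_le μ ha F (half_pos hpos)
  refine ⟨K₀ + 1, fun x ↦ ?_⟩
  by_contra! hx
  have h := hK₀ (K₀ + 1) (Nat.le_succ _) x
  have hF : ∫ y, F y ∂μ = ((∫ y, f y ∂μ : ℝ) : ℂ) := integral_ofReal
  have hzero : ∑ k ∈ Finset.range (K₀ + 1), F (x + k • a) = 0 :=
    Finset.sum_eq_zero fun k hk ↦ by
      simpa [F] using hf0 (hx k (Finset.mem_range.1 hk))
  rw [hzero, hF, zero_sub, norm_neg, norm_mul, Complex.norm_natCast, Complex.norm_real,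
    Real.norm_of_nonneg hpos.le, mul_comm] at h
  have : (0 : ℝ) < (K₀ + 1 : ℕ) := by positivity
  nlinarith

end UnitAddTorus

lemma mFourier_coe_ne_one_of_linearIndependent {q : ℕ} {α : Fin q → ℝ}
    (hli : LinearIndependent ℚ (Fin.cons (1 : ℝ) α : Fin (q + 1) → ℝ)) {h : Fin q → ℤ}
    (h0 : h ≠ 0) : UnitAddTorus.mFourier h (fun i ↦ (α i : UnitAddCircle)) ≠ 1 := by
  rw [UnitAddTorus.mFourier_apply_coe, Ne, Complex.exp_eq_one_iff]
  rintro ⟨n, hn⟩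
  have hn' : ∑ i, (h i : ℝ) * α i = n := by
    exact_mod_cast mul_right_cancel₀ Complex.two_pi_I_ne_zero hn
  have key := Fintype.linearIndependent_iff.1 hli
    (Fin.cons (-n : ℚ) fun i ↦ (h i : ℚ)) (by
      simp [Fin.sum_univ_succ, Rat.smul_def, hn'])
  exact h0 (funext fun i ↦ by simpa using key i.succ)

lemma fract_mem_of_coe_mem_image {b y : ℝ} (hb : b ≤ 1)
    (hy : (y : UnitAddCircle) ∈ ((↑) : ℝ → UnitAddCircle) '' Ioo 0 b) :
    Int.fract y ∈ Ico 0 b := by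
  obtain ⟨t, ht, hty⟩ := hy
  have hfr : Int.fract y = t := by
    rw [Int.fract_eq_iff]
    refine ⟨ht.1.le, ht.2.trans_le hb, ?_⟩
    have h0 : ((y - t : ℝ) : UnitAddCircle) = 0 := by
      rw [AddCircle.coe_sub, hty, sub_self]
    obtain ⟨n, hn⟩ := (AddCircle.coe_eq_zero_iff 1).1 h0
    exact ⟨n, by simpa using hn.symm⟩
  rw [hfr]
  exact ⟨ht.1.le, ht.2⟩

/-- if `α₁, …, α_q` are irrational and `1, α₁, …, α_q` are linearly
independent over `ℚ`, then for every box `[0, b₁) × ⋯ × [0, b_q) ⊂ [0,1)^q` of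
positive volume there exists `K` such that among any `K` consecutive elements of the
Kronecker sequence `({n α₁}, …, {n α_q})_{n ≥ 1}` at least one lies in the box. -/
theorem kronecker_hits_corner_box (q : ℕ) (α : Fin q → ℝ)
    (hirr : ∀ i : Fin q, Irrational (α i))
    (hli : LinearIndependent ℚ (Fin.cons (1 : ℝ) α : Fin (q + 1) → ℝ))
    (b : Fin q → ℝ) (hb : ∀ i : Fin q, 0 < b i ∧ b i ≤ 1) :
    ∃ K : ℕ, 1 ≤ K ∧ ∀ N : ℕ, ∃ k : ℕ, 1 ≤ k ∧ k ≤ K ∧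
      ∀ i : Fin q, Int.fract (((N + k : ℕ) : ℝ) * α i) ∈ Set.Ico 0 (b i) := by
  obtain ⟨K, hK⟩ := UnitAddTorus.exists_forall_exists_add_nsmul_mem
    (fun h h0 ↦ mFourier_coe_ne_one_of_linearIndependent hli (h := h) h0)
    (U := univ.pi fun i ↦ ((↑) : ℝ → UnitAddCircle) '' Ioo 0 (b i))
    (isOpen_set_pi finite_univ fun i _ ↦ QuotientAddGroup.isOpenMap_coe _ isOpen_Ioo)
    (univ_pi_nonempty_iff.2 fun i ↦ (nonempty_Ioo.2 (hb i).1).image _)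
  refine ⟨K + 1, Nat.le_add_left _ _, fun N ↦ ?_⟩
  obtain ⟨k, hk, hmem⟩ := hK ((N + 1) • fun i ↦ (α i : UnitAddCircle))
  refine ⟨k + 1, by omega, by omega, fun i ↦ fract_mem_of_coe_mem_image (hb i).2 ?_⟩
  rw [← add_nsmul] at hmem
  convert! hmem i (mem_univ i) using 1
  rw [Pi.smul_apply, ← AddCircle.coe_nsmul, nsmul_eq_mul]
  congr 3
  ring
end

section
/- Let α be irrational and let q_n be the denominator of the n-th convergent of the continued fraction expansion of α. Then the sequence ({(q_n + n)α})_{n≥1} is uniformly distributed modulo 1, and every interval of the form [{k_1 α}, {k_2 α}) with k_1, k_2 ∈ ℕ and {k_1 α} < {k_2 α} is a bounded remainder set (BRS) for ({(q_n + n)α})_{n≥1}. -/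
open Finset Filter

/-- The denominator `q_n` of the `n`-th convergent of the continued fraction
expansion of `α` (as a real number). -/
noncomputable def cfDen (α : ℝ) (n : ℕ) : ℝ :=
  (GenContFract.of α).dens n

open GenContFract

/-- The continued fraction expansion of an irrational number never terminates. -/
lemma not_terminatedAt_of_irrational {α : ℝ} (hα : Irrational α) (n : ℕ) :
    ¬ (GenContFract.of α).TerminatedAt n := fun h => by
  obtain ⟨q, hq⟩ := (terminates_iff_rat α).1 ⟨n, h⟩
  exact hα ⟨q, hq.symm⟩

lemma exists_int_contsAux (α : ℝ) (n : ℕ) :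
    (∃ a b : ℤ, (GenContFract.of α).contsAux n = ⟨a, b⟩) ∧
      ∃ a b : ℤ, (GenContFract.of α).contsAux (n + 1) = ⟨a, b⟩ := by
  induction n with
  | zero => exact ⟨⟨1, 0, by simp [contsAux]⟩, ⟨⌊α⌋, 1, by simp [contsAux, of_h_eq_floor]⟩⟩
  | succ n ih =>
    refine ⟨ih.2, ?_⟩
    obtain ⟨⟨a, b, h⟩, ⟨a', b', h'⟩⟩ := ih
    rcases hs : (GenContFract.of α).s.get? n with _ | gp
    · refine ⟨a', b', ?_⟩
      rw [← h']
      exact contsAux_stable_step_of_terminated hs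
    · obtain ⟨h1, z, hz⟩ := of_partNum_eq_one_and_exists_int_partDen_eq hs
      refine ⟨z * a' + a, z * b' + b, ?_⟩
      rw [contsAux_recurrence hs h h', h1, hz]
      simp

lemma exists_int_nums_dens (α : ℝ) :
    ∃ p q : ℕ → ℤ, ∀ n, (GenContFract.of α).nums n = p n ∧ (GenContFract.of α).dens n = q n := by
  have h : ∀ n, ∃ pq : ℤ × ℤ,
      (GenContFract.of α).nums n = pq.1 ∧ (GenContFract.of α).dens n = pq.2 := fun n => by
    obtain ⟨a, b, h⟩ := (exists_int_contsAux α n).2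
    refine ⟨(a, b), ?_⟩
    rw [num_eq_conts_a, den_eq_conts_b, nth_cont_eq_succ_nth_contAux, h]
    exact ⟨rfl, rfl⟩
  choose f hf using h
  exact ⟨fun n => (f n).1, fun n => (f n).2, hf⟩

lemma cfDen_add_le {α : ℝ} (hα : Irrational α) (n : ℕ) :
    cfDen α (n + 1) + cfDen α n ≤ cfDen α (n + 2) := by
  obtain ⟨gp, hs⟩ := Option.ne_none_iff_exists'.1 (not_terminatedAt_of_irrational hα (n + 1))
  have h1 := (of_partNum_eq_one_and_exists_int_partDen_eq hs).1
  have hb : 1 ≤ gp.b := of_one_le_get?_partDen (partDen_eq_s_b hs)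
  have hr := dens_recurrence hs rfl rfl
  have h0 : 0 ≤ (GenContFract.of α).dens (n + 1) := zero_le_of_den
  unfold cfDen
  rw [hr, h1]
  nlinarith

lemma two_mul_le_fib_add (n : ℕ) : 2 * n ≤ Nat.fib n + 5 := by
  rcases lt_or_ge n 6 with h | h
  · interval_cases n <;> decide
  · induction n, h using Nat.le_induction with
    | base => decide
    | succ n hn ih =>
      have := Nat.le_fib_self (n := n - 1) (by omega)
      have h2 := Nat.fib_add_two (n := n - 1)
      rw [show n - 1 + 2 = n + 1 by omega, show n - 1 + 1 = n by omega] at h2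
      omega

lemma fib_le_cfDen {α : ℝ} (hα : Irrational α) (n : ℕ) : (Nat.fib (n + 1) : ℝ) ≤ cfDen α n :=
  succ_nth_fib_le_of_nth_den (Or.inr (not_terminatedAt_of_irrational hα _))

lemma cfDen_pos {α : ℝ} (hα : Irrational α) (n : ℕ) : 0 < cfDen α n :=
  lt_of_lt_of_le (by exact_mod_cast Nat.fib_pos.2 n.succ_pos) (fib_le_cfDen hα n)

lemma abs_cfDen_mul_sub_le {α : ℝ} (hα : Irrational α) (n : ℕ) :
    |cfDen α n * α - (GenContFract.of α).nums n| ≤ 1 / cfDen α (n + 1) := by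
  have h := abs_sub_convs_le (not_terminatedAt_of_irrational hα n)
  have hq := cfDen_pos hα n
  have hq' := cfDen_pos hα (n + 1)
  rw [conv_eq_num_div_den] at h
  change |α - _ / cfDen α n| ≤ 1 / (cfDen α n * cfDen α (n + 1)) at h
  have e : cfDen α n * α - (GenContFract.of α).nums n =
      cfDen α n * (α - (GenContFract.of α).nums n / cfDen α n) := by field_simp
  rw [e, abs_mul, abs_of_pos hq]
  calc _ ≤ cfDen α n * (1 / (cfDen α n * cfDen α (n + 1))) := by gcongr
    _ = _ := by field_simp

/-- A multiple `m α` with `0 < |m| < q_n` is farther from the integers than `q_{n+1} α` is. -/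
lemma abs_lt_abs_of_abs_lt_cfDen {α : ℝ} (hα : Irrational α) {n : ℕ} {m : ℤ} (hm : m ≠ 0)
    (hmq : |(m : ℝ)| < cfDen α n) (l : ℤ) :
    |cfDen α (n + 1) * α - (GenContFract.of α).nums (n + 1)| < |m * α - l| := by
  by_contra! hle
  obtain ⟨p, q, hpq⟩ := exists_int_nums_dens α
  have hd : ∀ n, cfDen α n = q n := fun n => (hpq n).2
  have hdet := (SimpContFract.of α).determinant (not_terminatedAt_of_irrational hα n)
  have hcop : IsCoprime (q (n + 1)) (p (n + 1)) := by
    change (GenContFract.of α).nums n * (GenContFract.of α).dens (n + 1) -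
      (GenContFract.of α).dens n * (GenContFract.of α).nums (n + 1) = (-1) ^ (n + 1) at hdet
    rw [(hpq n).1, (hpq n).2, (hpq (n + 1)).1, (hpq (n + 1)).2] at hdet
    norm_cast at hdet
    refine ⟨(-1) ^ (n + 1) * p n, -((-1) ^ (n + 1) * q n), ?_⟩
    have h1 : ((-1 : ℤ) ^ (n + 1)) * (-1) ^ (n + 1) = 1 := by rw [← mul_pow]; simp
    push_cast at hdet
    linear_combination (-1 : ℤ) ^ (n + 1) * hdet + h1
  have hδ := abs_cfDen_mul_sub_le hα (n + 1)
  have hadd := cfDen_add_le hα n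
  have hmono : cfDen α n ≤ cfDen α (n + 1) := of_den_mono
  have hq1 := cfDen_pos hα (n + 1)
  have hq2 := cfDen_pos hα (n + 2)
  have hlt : |((m * p (n + 1) - l * q (n + 1) : ℤ) : ℝ)| < 1 := by
    have e : ((m * p (n + 1) - l * q (n + 1) : ℤ) : ℝ) =
        cfDen α (n + 1) * (m * α - l)
          - m * (cfDen α (n + 1) * α - (GenContFract.of α).nums (n + 1)) := by
      rw [hd, (hpq (n + 1)).1]; push_cast; ring
    rw [e]
    calc _ ≤ |cfDen α (n + 1) * (m * α - l)|
          + |m * (cfDen α (n + 1) * α - (GenContFract.of α).nums (n + 1))| := abs_sub _ _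
      _ ≤ cfDen α (n + 1) * (1 / cfDen α (n + 2)) + |(m : ℝ)| * (1 / cfDen α (n + 2)) := by
          rw [abs_mul, abs_mul, abs_of_pos hq1]
          gcongr
          exact hle.trans hδ
      _ < 1 := by
          rw [← add_mul, mul_one_div, div_lt_one hq2]
          linarith
  rw [← Int.cast_abs] at hlt
  have hzero : m * p (n + 1) - l * q (n + 1) = 0 := Int.abs_lt_one_iff.1 (by exact_mod_cast hlt)
  have hdvd : q (n + 1) ∣ m := by
    refine hcop.dvd_of_dvd_mul_right ⟨l, ?_⟩
    linarith
  have hle' := Int.le_of_dvd (abs_pos.2 hm) ((dvd_abs _ _).2 hdvd)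
  have : ((q (n + 1) : ℤ) : ℝ) ≤ |(m : ℝ)| := by exact_mod_cast hle'
  rw [← hd] at this
  linarith

lemma fract_add_eq_of_abs_lt {y δ : ℝ} (h : ∀ l : ℤ, |δ| < |y - l|) :
    Int.fract (y + δ) = Int.fract y + δ := by
  have h0 := h ⌊y⌋
  have h1 := h (⌊y⌋ + 1)
  have e : y - ⌊y⌋ = Int.fract y := rfl
  have e1 : y - ((⌊y⌋ + 1 : ℤ) : ℝ) = Int.fract y - 1 := by rw [← e]; push_cast; ring
  have hf := Int.fract_nonneg y
  have hf1 := Int.fract_lt_one y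
  rw [e, abs_of_nonneg hf] at h0
  rw [e1, abs_sub_comm, abs_of_nonneg (by linarith : 0 ≤ 1 - Int.fract y)] at h1
  have := abs_lt.1 h0
  have := abs_lt.1 h1
  rw [Int.fract_eq_iff]
  refine ⟨by linarith, by linarith, ⌊y⌋, ?_⟩
  rw [← e]; ring

/-- Eventually, shifting by `q_n α` moves `{(n - k) α}` by `q_n α - p_n`, without wrapping. -/
lemma eventually_fract_cfDen_add {α : ℝ} (hα : Irrational α) (k : ℤ) :
    ∀ᶠ n : ℕ in atTop, Int.fract ((cfDen α n + n - k) * α) =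
      Int.fract ((n - k) * α) + (cfDen α n * α - (GenContFract.of α).nums n) := by
  filter_upwards [eventually_ge_atTop (k.natAbs + 10)] with n hn
  obtain ⟨n, rfl⟩ : ∃ j, n = j + 1 := ⟨n - 1, by omega⟩
  have hm : (0 : ℤ) < (n + 1 : ℕ) - k := by omega
  have hmq : |(((n + 1 : ℕ) - k : ℤ) : ℝ)| < cfDen α n := by
    refine lt_of_lt_of_le ?_ (fib_le_cfDen hα n)
    have := two_mul_le_fib_add (n + 1)
    rw [abs_of_pos (by exact_mod_cast hm)]
    have h : ((n + 1 : ℕ) - k : ℤ) < (Nat.fib (n + 1) : ℤ) := by omega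
    exact_mod_cast h
  have key := fract_add_eq_of_abs_lt (abs_lt_abs_of_abs_lt_cfDen hα hm.ne' hmq)
  obtain ⟨p, q, hpq⟩ := exists_int_nums_dens α
  rw [(hpq (n + 1)).1] at key ⊢
  push_cast at key ⊢
  rw [← key, ← Int.fract_sub_intCast _ (p (n + 1))]
  congr 1
  ring

lemma sum_indicator_eq_sum_fract_sub (s : ℕ → ℝ) (β : ℝ) (N : ℕ) :
    (cnt (fun n => Int.fract (s n)) 0 (Int.fract β) N : ℝ) - N * Int.fract β =
      ∑ n ∈ Finset.Icc 1 N, (Int.fract (s n - β) - Int.fract (s n)) := by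
  have h : ∀ x : ℝ, Int.fract (x - β) - Int.fract x =
      (if Int.fract x ∈ Set.Ico 0 (Int.fract β) then 1 else 0) - Int.fract β := fun x => by
    have hx := Int.fract_nonneg x
    have hx1 := Int.fract_lt_one x
    have hb := Int.fract_nonneg β
    have hb1 := Int.fract_lt_one β
    have ex : x - Int.fract x = ⌊x⌋ := by rw [Int.self_sub_fract]
    have eb : β - Int.fract β = ⌊β⌋ := by rw [Int.self_sub_fract]
    split_ifs with hc
    · have : Int.fract (x - β) = Int.fract x - Int.fract β + 1 := by
        rw [Int.fract_eq_iff]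
        refine ⟨by linarith, by linarith [hc.2], ⌊x⌋ - ⌊β⌋ - 1, ?_⟩
        push_cast
        linarith
      linarith
    · have hc' : Int.fract β ≤ Int.fract x := by
        by_contra! hlt
        exact hc ⟨hx, hlt⟩
      have : Int.fract (x - β) = Int.fract x - Int.fract β := by
        rw [Int.fract_eq_iff]
        refine ⟨by linarith, by linarith, ⌊x⌋ - ⌊β⌋, ?_⟩
        push_cast
        linarith
      linarith
  simp only [h, Finset.sum_sub_distrib]
  rw [cnt, Finset.sum_boole]
  simp

lemma abs_sum_Icc_shift_sub_le (g : ℤ → ℝ) (hg : ∀ n, |g n| ≤ 1) (k : ℤ) (N : ℕ) :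
    |∑ n ∈ Finset.Icc 1 N, (g (n - k) - g n)| ≤ 2 * |(k : ℝ)| := by
  have tele : ∀ (j : ℤ) (N : ℕ),
      ∑ n ∈ Finset.Icc 1 N, (g (n - (j + 1)) - g (n - j)) = g (-j) - g (N - j) := fun j N => by
    induction N with
    | zero => simp
    | succ N ih =>
      rw [Finset.sum_Icc_succ_top (by omega), ih]
      push_cast
      rw [show (N : ℤ) + 1 - (j + 1) = N - j by ring]
      ring
  have step : ∀ j : ℤ, |∑ n ∈ Finset.Icc 1 N, (g (n - (j + 1)) - g n)
      - ∑ n ∈ Finset.Icc 1 N, (g (n - j) - g n)| ≤ 2 := fun j => by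
    rw [← Finset.sum_sub_distrib]
    simp only [sub_sub_sub_cancel_right]
    rw [tele]
    exact (abs_sub _ _).trans (by linarith [hg (-j), hg (N - j)])
  induction k using Int.induction_on with
  | zero => simp
  | succ i ih =>
    have := abs_le.1 (step i)
    have := abs_le.1 ih
    push_cast at *
    have hi : (0 : ℝ) ≤ i := Nat.cast_nonneg i
    rw [abs_of_nonneg hi] at this
    rw [abs_of_nonneg (by linarith : (0 : ℝ) ≤ i + 1)]
    exact abs_le.2 ⟨by linarith, by linarith⟩
  | pred i ih =>
    have h := abs_le.1 (step (-i - 1))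
    rw [sub_add_cancel] at h
    have := abs_le.1 ih
    push_cast at *
    have hi : (0 : ℝ) ≤ i := Nat.cast_nonneg i
    rw [abs_neg, abs_of_nonneg hi] at this
    rw [abs_of_nonpos (by linarith : -(i : ℝ) - 1 ≤ 0)]
    exact abs_le.2 ⟨by linarith, by linarith⟩

lemma exists_abs_sum_Icc_le {e : ℕ → ℝ} (he : ∀ᶠ n in atTop, e n = 0) :
    ∃ C, ∀ N, |∑ n ∈ Finset.Icc 1 N, e n| ≤ C := by
  obtain ⟨M, hM⟩ := eventually_atTop.1 he
  refine ⟨∑ n ∈ Finset.range M, |e n|, fun N => ?_⟩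
  refine (Finset.abs_sum_le_sum_abs _ _).trans ?_
  rw [← Finset.sum_filter_of_ne (p := fun n => n < M)]
  · refine Finset.sum_le_sum_of_subset_of_nonneg (fun n hn => ?_) fun _ _ _ => abs_nonneg _
    exact Finset.mem_range.2 (Finset.mem_filter.1 hn).2
  · intro n _ hn
    by_contra! h
    exact hn (by rw [hM n h, abs_zero])

/-- The intervals `[0, {kα})` are bounded remainder sets, for every integer `k`. -/
lemma isBRS_zero_fract {α : ℝ} (hα : Irrational α) (k : ℤ) :
    IsBRS (fun n : ℕ => Int.fract ((cfDen α n + (n : ℝ)) * α)) 0 (Int.fract (k * α)) := by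
  set g : ℤ → ℝ := fun n => Int.fract (n * α)
  have hg : ∀ n, |g n| ≤ 1 := fun n => by
    rw [abs_of_nonneg (Int.fract_nonneg _)]
    exact (Int.fract_lt_one _).le
  obtain ⟨C, hC⟩ := exists_abs_sum_Icc_le (e := fun n : ℕ =>
      (Int.fract ((cfDen α n + n) * α - k * α) - Int.fract ((cfDen α n + n) * α))
        - (g (n - k) - g n)) (by
    filter_upwards [eventually_fract_cfDen_add hα k, eventually_fract_cfDen_add hα 0] with n h h0
    simp only [Int.cast_zero, sub_zero] at h0
    rw [← sub_mul, h, h0]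
    simp only [g]
    push_cast
    ring)
  refine ⟨2 * |(k : ℝ)| + C, fun N _ => ?_⟩
  rw [sub_zero, sum_indicator_eq_sum_fract_sub (fun n : ℕ => (cfDen α n + (n : ℝ)) * α)]
  have h1 := hC N
  rw [Finset.sum_sub_distrib] at h1
  have h1 := abs_le.1 h1
  have h2 := abs_le.1 (abs_sum_Icc_shift_sub_le g hg k N)
  exact abs_le.2 ⟨by linarith, by linarith⟩

lemma cnt_zero_add_cnt (x : ℕ → ℝ) {a b : ℝ} (ha : 0 ≤ a) (hab : a ≤ b) (N : ℕ) :
    cnt x 0 a N + cnt x a b N = cnt x 0 b N := by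
  unfold cnt
  rw [← Finset.card_union_of_disjoint]
  · congr 1
    ext n
    simp only [Finset.mem_union, Finset.mem_filter, ← and_or_left, ← Set.mem_union,
      Set.Ico_union_Ico_eq_Ico ha hab]
  · refine Finset.disjoint_filter.2 fun n _ h h' => ?_
    exact (h.2.trans_le h'.1).false

lemma IsBRS.sub {x : ℕ → ℝ} {a b : ℝ} (ha : 0 ≤ a) (hab : a ≤ b)
    (h : IsBRS x 0 a) (h' : IsBRS x 0 b) : IsBRS x a b := by
  obtain ⟨C, hC⟩ := h
  obtain ⟨C', hC'⟩ := h'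
  refine ⟨C + C', fun N hN => ?_⟩
  have e : (cnt x 0 a N : ℝ) + cnt x a b N = cnt x 0 b N := by
    exact_mod_cast cnt_zero_add_cnt x ha hab N
  have h1 := abs_le.1 (hC N hN)
  have h2 := abs_le.1 (hC' N hN)
  exact abs_le.2 ⟨by linarith, by linarith⟩

lemma IsBRS.tendsto {x : ℕ → ℝ} {a b : ℝ} (h : IsBRS x a b) :
    Tendsto (fun N : ℕ => (cnt x a b N : ℝ) / N) atTop (nhds (b - a)) := by
  obtain ⟨C, hC⟩ := h
  rw [tendsto_iff_norm_sub_tendsto_zero]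
  refine squeeze_zero' (Eventually.of_forall fun _ => norm_nonneg _) ?_
    (tendsto_const_div_atTop_nhds_zero_nat C)
  filter_upwards [eventually_ge_atTop 1] with N hN
  have hN' : (0 : ℝ) < N := by exact_mod_cast hN
  have e : (cnt x a b N : ℝ) / N - (b - a) = (cnt x a b N - N * (b - a)) / N := by field_simp
  rw [Real.norm_eq_abs, e, abs_div, abs_of_pos hN']
  gcongr
  exact hC N hN

lemma cnt_mono (x : ℕ → ℝ) (a : ℝ) {b c : ℝ} (h : b ≤ c) (N : ℕ) : cnt x a b N ≤ cnt x a c N :=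
  Finset.card_le_card <| Finset.monotone_filter_right _ fun _ _ hn => ⟨hn.1, hn.2.trans_le h⟩

lemma cnt_zero_one {x : ℕ → ℝ} (hx : ∀ n, x n ∈ Set.Ico (0 : ℝ) 1) (N : ℕ) : cnt x 0 1 N = N := by
  simp only [cnt, hx, Finset.filter_true, Nat.card_Icc, Nat.add_sub_cancel]

/-- A sequence with bounded remainder sets `[0, t)` for a dense set of `t` is uniformly
distributed. -/
lemma isUD_of_dense_isBRS {x : ℕ → ℝ} (hx : ∀ n, x n ∈ Set.Ico (0 : ℝ) 1)
    (hd : ∀ s t : ℝ, 0 ≤ s → s < t → t ≤ 1 → ∃ u, s < u ∧ u < t ∧ IsBRS x 0 u) : IsUD x := by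
  have key : ∀ t : ℝ, 0 ≤ t → t ≤ 1 →
      Tendsto (fun N : ℕ => (cnt x 0 t N : ℝ) / N) atTop (nhds t) := fun t h0 h1 => by
    rw [tendsto_order]
    constructor
    · intro s hs
      rcases lt_or_ge s 0 with hs0 | hs0
      · exact Eventually.of_forall fun N => hs0.trans_le (by positivity)
      · obtain ⟨u, hsu, hut, hu⟩ := hd s t hs0 hs h1
        have hu' := hu.tendsto
        rw [sub_zero] at hu'
        filter_upwards [hu'.eventually (lt_mem_nhds hsu)] with N hN
        refine hN.trans_le ?_
        gcongr
        exact cnt_mono x 0 hut.le N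
    · intro s hs
      rcases lt_or_ge 1 s with hs1 | hs1
      · refine Eventually.of_forall fun N => lt_of_le_of_lt (div_le_one_of_le₀ ?_ (by positivity)) hs1
        exact_mod_cast (cnt_mono x 0 h1 N).trans (cnt_zero_one hx N).le
      · obtain ⟨u, htu, hus, hu⟩ := hd t s h0 hs hs1
        have hu' := hu.tendsto
        rw [sub_zero] at hu'
        filter_upwards [hu'.eventually (gt_mem_nhds hus)] with N hN
        refine lt_of_le_of_lt ?_ hN
        gcongr
        exact cnt_mono x 0 htu.le N
  intro a b ha hab hb
  refine ((key b (ha.trans hab) hb).sub (key a ha (hab.trans hb))).congr fun N => ?_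
  have e : (cnt x 0 a N : ℝ) + cnt x a b N = cnt x 0 b N := by
    exact_mod_cast cnt_zero_add_cnt x ha hab N
  rw [← sub_div, ← e, add_sub_cancel_left]

lemma exists_fract_int_mul_mem_Ioo {α : ℝ} (hα : Irrational α) {s t : ℝ} (hs : 0 ≤ s)
    (hst : s < t) (ht : t ≤ 1) : ∃ k : ℤ, Int.fract (k * α) ∈ Set.Ioo s t := by
  have hd : Dense (AddSubgroup.closure {α, 1} : Set ℝ) :=
    dense_addSubgroupClosure_pair_iff.2 (by simpa using hα)
  obtain ⟨u, hu, hmem⟩ := hd.exists_mem_open isOpen_Ioo (Set.nonempty_Ioo.2 hst)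
  obtain ⟨k, m, rfl⟩ := AddSubgroup.mem_closure_pair.1 hu
  refine ⟨k, ?_⟩
  simp only [zsmul_eq_mul, mul_one] at hmem
  rwa [← Int.fract_add_intCast _ m, Int.fract_eq_self.2 ⟨hs.trans hmem.1.le, hmem.2.trans_le ht⟩]

/-- for irrational `α` the sequence `({(q_n + n) α})_{n ≥ 1}` is
uniformly distributed mod 1, and every interval `[{k₁α}, {k₂α})` with
`{k₁α} < {k₂α}` is a BRS for it. -/
theorem ud_and_brs_for_qn_plus_n (α : ℝ) (hα : Irrational α) :
    IsUD (fun n : ℕ => Int.fract ((cfDen α n + (n : ℝ)) * α)) ∧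
    ∀ k₁ k₂ : ℕ, Int.fract ((k₁ : ℝ) * α) < Int.fract ((k₂ : ℝ) * α) →
      IsBRS (fun n : ℕ => Int.fract ((cfDen α n + (n : ℝ)) * α))
        (Int.fract ((k₁ : ℝ) * α)) (Int.fract ((k₂ : ℝ) * α)) := by
  refine ⟨isUD_of_dense_isBRS (fun n => ⟨Int.fract_nonneg _, Int.fract_lt_one _⟩) ?_, ?_⟩
  · intro s t hs hst ht
    obtain ⟨k, hk⟩ := exists_fract_int_mul_mem_Ioo hα hs hst ht
    exact ⟨_, hk.1, hk.2, isBRS_zero_fract hα k⟩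
  · intro k₁ k₂ hk
    exact IsBRS.sub (Int.fract_nonneg _) hk.le (by simpa using isBRS_zero_fract hα k₁)
      (by simpa using isBRS_zero_fract hα k₂)
end

section
/- Let α be irrational, let q_n be the denominator of the n-th convergent of the continued fraction expansion of α, and set a_n = q_n + n. Let k_1, k_2 ∈ ℕ with {k_1 α} < {k_2 α} and J = [{k_1 α}, {k_2 α}). Then with k = max(k_1 + 1, k_2 + 1, 4) it holds for all N ∈ ℕ, N ≥ k, that #{k ≤ n ≤ N : {a_n α} ∈ J} = #{k ≤ n ≤ N : {n α} ∈ J}. -/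
namespace GenContFract

theorem exists_int_eq_of_contsAux (v : ℝ) (n : ℕ) :
    ∃ a b : ℤ, (GenContFract.of v).contsAux n = ⟨(a : ℝ), (b : ℝ)⟩ := by
  suffices H : (∃ a b : ℤ, (GenContFract.of v).contsAux n = ⟨(a : ℝ), (b : ℝ)⟩) ∧
      ∃ a b : ℤ, (GenContFract.of v).contsAux (n + 1) = ⟨(a : ℝ), (b : ℝ)⟩ from H.1
  induction n with
  | zero =>
    exact ⟨⟨1, 0, by simp⟩, ⟨⌊v⌋, 1, by simp⟩⟩
  | succ n ih =>
    refine ⟨ih.2, ?_⟩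
    obtain ⟨⟨a, b, h⟩, ⟨a', b', h'⟩⟩ := ih
    rcases hs : (GenContFract.of v).s.get? n with _ | gp
    · exact ⟨a', b', by rw [← h', contsAux_stable_step_of_terminated hs]⟩
    · obtain ⟨h1, z, hz⟩ := of_partNum_eq_one_and_exists_int_partDen_eq hs
      refine ⟨z * a' + a, z * b' + b, ?_⟩
      rw [contsAux_recurrence hs h h', h1, hz]
      push_cast
      simp

theorem exists_int_eq_nums (v : ℝ) (n : ℕ) : ∃ a : ℤ, (GenContFract.of v).nums n = a := by
  obtain ⟨a, b, h⟩ := exists_int_eq_of_contsAux v (n + 1)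
  exact ⟨a, by rw [num_eq_conts_a, nth_cont_eq_succ_nth_contAux, h]⟩

theorem exists_int_eq_dens (v : ℝ) (n : ℕ) : ∃ b : ℤ, (GenContFract.of v).dens n = b := by
  obtain ⟨a, b, h⟩ := exists_int_eq_of_contsAux v (n + 1)
  exact ⟨b, by rw [den_eq_conts_b, nth_cont_eq_succ_nth_contAux, h]⟩

theorem not_terminatedAt_of_irrational {v : ℝ} (hv : Irrational v) (n : ℕ) :
    ¬(GenContFract.of v).TerminatedAt n := fun h =>
  hv <| by
    obtain ⟨q, hq⟩ := exists_rat_eq_of_terminates ⟨n, h⟩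
    exact ⟨q, hq.symm⟩

theorem dens_pos_of_irrational {v : ℝ} (hv : Irrational v) (n : ℕ) : 0 < (GenContFract.of v).dens n :=
  lt_of_lt_of_le (by exact_mod_cast Nat.fib_pos.2 n.succ_pos)
    (succ_nth_fib_le_of_nth_den (Or.inr (not_terminatedAt_of_irrational hv _)))

theorem abs_dens_mul_sub_nums_mul_le {v : ℝ} (hv : Irrational v) (n : ℕ) :
    |(GenContFract.of v).dens n * v - (GenContFract.of v).nums n| * (GenContFract.of v).dens (n + 1) ≤ 1 := by
  have hq := dens_pos_of_irrational hv n
  have hq' := dens_pos_of_irrational hv (n + 1)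
  have h := abs_sub_convs_le (not_terminatedAt_of_irrational hv n)
  have e : (GenContFract.of v).dens n * v - (GenContFract.of v).nums n = (GenContFract.of v).dens n * (v - (GenContFract.of v).convs n) := by
    rw [conv_eq_num_div_den]
    field_simp
  rw [le_div_iff₀ (by positivity)] at h
  rw [e, abs_mul, abs_of_pos hq]
  linarith

end GenContFract

theorem Irrational.int_mul_sub_int_ne_zero {α : ℝ} (hα : Irrational α) {q : ℤ} (hq : q ≠ 0)
    (p : ℤ) : (q : ℝ) * α - p ≠ 0 :=
  ((hα.intCast_mul hq).sub_intCast p).ne_zero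

theorem abs_mul_sub_lt_of_unimodular {α : ℝ} {p q p' q' ε m : ℤ}
    (hε : ε * ε = 1) (hdet : p * q' - q * p' = ε)
    (hsign : ((q : ℝ) * α - p) * ((q' : ℝ) * α - p') < 0)
    (hm : 0 < m) (hmq : m < q) (hqq : q ≤ q') (j : ℤ) :
    |(q : ℝ) * α - p| < |(m : ℝ) * α - j| := by
  obtain ⟨u, v, hu, hv⟩ : ∃ u v : ℤ, m = u * q + v * q' ∧ j = u * p + v * p' :=
    ⟨ε * (j * q' - m * p'), ε * (m * p - j * q), by linear_combination -m * hε - ε * m * hdet,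
      by linear_combination -j * hε - ε * j * hdet⟩
  have e : (m : ℝ) * α - j = u * ((q : ℝ) * α - p) + v * ((q' : ℝ) * α - p') := by
    rw [hu, hv]; push_cast; ring
  have huv : (1 ≤ u ∧ v ≤ -1) ∨ (u ≤ -1 ∧ 1 ≤ v) := by
    rcases lt_trichotomy u 0 with h | h | h <;> rcases lt_trichotomy v 0 with h' | h' | h'
    · nlinarith
    · nlinarith
    · right; omega
    · nlinarith
    · subst h h'; omega
    · nlinarith
    · left; omega
    · nlinarith
    · nlinarith
  rw [e]
  generalize (q : ℝ) * α - p = x at *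
  generalize (q' : ℝ) * α - p' = y at *
  have huv' : ((1 : ℝ) ≤ u ∧ (v : ℝ) ≤ -1) ∨ ((u : ℝ) ≤ -1 ∧ (1 : ℝ) ≤ v) := by
    exact_mod_cast huv
  rcases mul_neg_iff.1 hsign with ⟨hx, hy⟩ | ⟨hx, hy⟩
  · rw [abs_of_pos hx, lt_abs]
    rcases huv' with ⟨h1, h2⟩ | ⟨h1, h2⟩
    · left; nlinarith
    · right; nlinarith
  · rw [abs_of_neg hx, lt_abs]
    rcases huv' with ⟨h1, h2⟩ | ⟨h1, h2⟩
    · right; nlinarith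
    · left; nlinarith

theorem exists_dens_eq_and_forall_abs_lt {α : ℝ} (hα : Irrational α) (n : ℕ) :
    ∃ q p : ℤ, (GenContFract.of α).dens n = q ∧
      ∀ m : ℤ, 0 < m → m < q → ∀ j : ℤ, |(q : ℝ) * α - p| < |(m : ℝ) * α - j| := by
  obtain ⟨q, hq⟩ := GenContFract.exists_int_eq_dens α n
  obtain ⟨p, hp⟩ := GenContFract.exists_int_eq_nums α n
  obtain ⟨q', hq'⟩ := GenContFract.exists_int_eq_dens α (n + 1)
  obtain ⟨p', hp'⟩ := GenContFract.exists_int_eq_nums α (n + 1)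
  refine ⟨q, p, hq, fun m hm hmq j => ?_⟩
  have hqpos := GenContFract.dens_pos_of_irrational hα n
  have hqpos' := GenContFract.dens_pos_of_irrational hα (n + 1)
  have hmono : (GenContFract.of α).dens n ≤ (GenContFract.of α).dens (n + 1) :=
    GenContFract.of_den_mono
  have hmono' : (GenContFract.of α).dens (n + 1) ≤ (GenContFract.of α).dens (n + 2) :=
    GenContFract.of_den_mono
  have hb := GenContFract.abs_dens_mul_sub_nums_mul_le hα n
  have hb' := GenContFract.abs_dens_mul_sub_nums_mul_le hα (n + 1)
  have hdet : (GenContFract.of α).nums n * (GenContFract.of α).dens (n + 1) -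
      (GenContFract.of α).dens n * (GenContFract.of α).nums (n + 1) = (-1) ^ (n + 1) :=
    (SimpContFract.of α).determinant (GenContFract.not_terminatedAt_of_irrational hα n)
  have hb'' : |(GenContFract.of α).dens (n + 1) * α - (GenContFract.of α).nums (n + 1)| *
      (GenContFract.of α).dens n ≤ 1 :=
    (mul_le_mul_of_nonneg_left (hmono.trans hmono') (abs_nonneg _)).trans hb'
  rw [hq, hq'] at hmono
  rw [hq] at hqpos
  rw [hq'] at hqpos'
  rw [hq, hp, hq'] at hb
  rw [hq, hp', hq'] at hb''
  rw [hq, hp, hp', hq'] at hdet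
  have hqz : 0 < q := by exact_mod_cast hqpos
  have hqz' : 0 < q' := by exact_mod_cast hqpos'
  have hx := hα.int_mul_sub_int_ne_zero hqz.ne' p
  have hy := hα.int_mul_sub_int_ne_zero hqz'.ne' p'
  have hε : ((-1 : ℤ) ^ (n + 1)) * (-1) ^ (n + 1) = 1 := by
    rw [← mul_pow]; simp
  refine abs_mul_sub_lt_of_unimodular hε (by exact_mod_cast hdet) ?_ hm hmq
    (by exact_mod_cast hmono) j
  have hrel : q * ((q' : ℝ) * α - p') - q' * ((q : ℝ) * α - p) = (-1) ^ (n + 1) := by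
    rw [← hdet]; ring
  generalize (q : ℝ) * α - p = x at *
  generalize (q' : ℝ) * α - p' = y at *
  by_contra! hxy
  have h1 : |x| * q' ≤ 1 := hb
  have hxy' : 0 < x * y := lt_of_le_of_ne hxy (mul_ne_zero hx hy).symm
  rcases neg_one_pow_eq_or ℝ (n + 1) with h | h <;> rw [h] at hrel <;>
  rcases mul_pos_iff.1 hxy' with ⟨h2, h3⟩ | ⟨h2, h3⟩
  · rw [abs_of_pos h3] at hb''
    nlinarith [mul_pos hqpos' h2]
  · rw [abs_of_neg h2] at hb
    nlinarith [mul_neg_of_pos_of_neg hqpos h3]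
  · rw [abs_of_pos h2] at hb
    nlinarith [mul_pos hqpos h3]
  · rw [abs_of_neg h3] at hb''
    nlinarith [mul_neg_of_pos_of_neg hqpos' h2]

theorem Int.fract_add_mem_Ico_iff {X δ A B : ℝ} (hA : ∀ j : ℤ, |δ| < |X - A - j|)
    (hB : ∀ j : ℤ, |δ| < |X - B - j|) :
    Int.fract (X + δ) ∈ Set.Ico (Int.fract A) (Int.fract B) ↔
      Int.fract X ∈ Set.Ico (Int.fract A) (Int.fract B) := by
  have key : ∀ C : ℝ, (∀ j : ℤ, |δ| < |X - C - j|) → ∀ j : ℤ,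
      |δ| < |Int.fract X - Int.fract C - j| := by
    intro C hC j
    have := hC (⌊X⌋ - ⌊C⌋ + j)
    convert this using 2
    rw [Int.fract, Int.fract]; push_cast; ring
  obtain ⟨e, he⟩ : ∃ e : ℤ, Int.fract (X + δ) = Int.fract X + δ + e :=
    ⟨⌊X⌋ - ⌊X + δ⌋, by rw [Int.fract, Int.fract]; push_cast; ring⟩
  have hA' := key A hA
  have hB' := key B hB
  have x0 := Int.fract_nonneg X
  have x1 := Int.fract_lt_one X
  have y0 := Int.fract_nonneg (X + δ)
  have y1 := Int.fract_lt_one (X + δ)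
  have a0 := Int.fract_nonneg A
  have a1 := Int.fract_lt_one A
  have b0 := Int.fract_nonneg B
  have b1 := Int.fract_lt_one B
  generalize Int.fract X = x at *
  generalize Int.fract (X + δ) = y at *
  generalize Int.fract A = a at *
  generalize Int.fract B = b at *
  have hA0 := hA' 0
  have hB0 := hB' 0
  have hA1 := hA' 1
  have hB1 := hB' 1
  have hA2 := hA' (-1)
  have hB2 := hB' (-1)
  have hδ : |δ| < 1 := hA0.trans (by rw [abs_lt]; push_cast; constructor <;> linarith)
  rw [abs_lt] at hδ
  have e2 : e < 2 := by have : (e : ℝ) < 2 := by linarith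
                        exact_mod_cast this
  have e1 : -2 < e := by have : (-2 : ℝ) < e := by linarith
                         exact_mod_cast this
  push_cast at hA0 hB0 hA1 hB1 hA2 hB2
  rw [lt_abs] at hA0 hB0 hA1 hB1 hA2 hB2
  have d1 := le_abs_self δ
  have d2 := neg_abs_le δ
  rw [Set.mem_Ico, Set.mem_Ico]
  have a_iff : e = 0 → (a ≤ y ↔ a ≤ x) := by
    rintro rfl
    push_cast at he
    constructor <;> intro h <;> rcases hA0 with h' | h' <;> linarith
  have b_iff : e = 0 → (y < b ↔ x < b) := by
    rintro rfl
    push_cast at he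
    constructor <;> intro h <;> rcases hB0 with h' | h' <;> linarith
  obtain rfl | rfl | rfl : e = -1 ∨ e = 0 ∨ e = 1 := by omega
  · push_cast at he
    constructor <;> rintro ⟨h, h'⟩ <;> exfalso
    · rcases hA1 with h1 | h1 <;> linarith
    · rcases hB0 with h1 | h1 <;> linarith
  · rw [a_iff rfl, b_iff rfl]
  · push_cast at he
    constructor <;> rintro ⟨h, h'⟩ <;> exfalso
    · rcases hB2 with h1 | h1 <;> linarith
    · rcases hA0 with h1 | h1 <;> linarith

theorem Nat.lt_fib_succ {n : ℕ} (hn : 4 ≤ n) : n < Nat.fib (n + 1) := by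
  rcases hn.eq_or_lt with rfl | h
  · decide
  · exact (Nat.le_fib_self h).trans_lt (Nat.fib_lt_fib_succ (by omega))

/-- for irrational `α`, `a_n = q_n + n`, `J = [{k₁α}, {k₂α})` and
`k = max(k₁ + 1, k₂ + 1, 4)`, for all `N ≥ k` the number of `k ≤ n ≤ N` with
`{a_n α} ∈ J` equals the number of `k ≤ n ≤ N` with `{n α} ∈ J`. -/
theorem count_eq_for_qn_plus_n (α : ℝ) (hα : Irrational α)
    (k₁ k₂ : ℕ) (hk : Int.fract ((k₁ : ℝ) * α) < Int.fract ((k₂ : ℝ) * α)) :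
    ∀ N : ℕ, max (max (k₁ + 1) (k₂ + 1)) 4 ≤ N →
      ((Finset.Icc (max (max (k₁ + 1) (k₂ + 1)) 4) N).filter
        (fun n : ℕ => Int.fract ((cfDen α n + (n : ℝ)) * α) ∈
          Set.Ico (Int.fract ((k₁ : ℝ) * α)) (Int.fract ((k₂ : ℝ) * α)))).card =
      ((Finset.Icc (max (max (k₁ + 1) (k₂ + 1)) 4) N).filter
        (fun n : ℕ => Int.fract ((n : ℝ) * α) ∈
          Set.Ico (Int.fract ((k₁ : ℝ) * α)) (Int.fract ((k₂ : ℝ) * α)))).card := by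
  intro N _
  congr 1
  refine Finset.filter_congr fun n hn => ?_
  have hkn := (Finset.mem_Icc.1 hn).1
  simp only [max_le_iff] at hkn
  obtain ⟨⟨hk₁, hk₂⟩, hn4⟩ := hkn
  obtain ⟨q, p, hq, hbest⟩ := exists_dens_eq_and_forall_abs_lt hα n
  have hnq : (n : ℤ) < q := by
    have h1 : ((Nat.fib (n + 1) : ℕ) : ℝ) ≤ (GenContFract.of α).dens n :=
      GenContFract.succ_nth_fib_le_of_nth_den
        (Or.inr (GenContFract.not_terminatedAt_of_irrational hα _))
    rw [hq] at h1
    have h2 : ((Nat.fib (n + 1) : ℕ) : ℤ) ≤ q := by exact_mod_cast h1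
    have h3 := Nat.lt_fib_succ hn4
    omega
  have hfar : ∀ c : ℕ, c + 1 ≤ n → ∀ j : ℤ, |(q : ℝ) * α - p| < |(n : ℝ) * α - c * α - j| := by
    intro c hc j
    have := hbest ((n : ℤ) - c) (by omega) (by omega) j
    push_cast at this
    rwa [sub_mul] at this
  rw [← Int.fract_add_mem_Ico_iff (hfar k₁ hk₁) (hfar k₂ hk₂), cfDen, hq]
  have e : ((q : ℝ) + n) * α = (n : ℝ) * α + (q * α - p) + p := by ring
  rw [e, Int.fract_add_intCast]
end

section
/- There exists an irrational number α and an interval J ⊆ [0,1) such that J is a bounded remainder set (BRS) for the sequence ({nα})_{n≥1} but J is not a BRS for the sequence ({(q_n + n)α})_{n≥1}, where q_n is the denominator of the n-th convergent of the continued fraction expansion of α. In particular, the sequences ({nα})_{n≥1} and ({(q_n + n)α})_{n≥1} do not in general have the same collection of BRS. -/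
open Finset Filter

/-- The golden mean `(√5 - 1) / 2`. -/
noncomputable def goldenMean : ℝ := -Real.goldenConj

lemma goldenMean_sq : goldenMean ^ 2 = 1 - goldenMean := by
  have := Real.goldenConj_sq
  unfold goldenMean
  linarith [neg_sq Real.goldenConj]

lemma goldenMean_pos : 0 < goldenMean := by
  have := Real.goldenConj_neg
  unfold goldenMean
  linarith

lemma goldenMean_lt : goldenMean < 0.62 := by
  nlinarith [goldenMean_sq, goldenMean_pos]

lemma goldenMean_gt : 0.61 < goldenMean := by
  nlinarith [goldenMean_sq, goldenMean_pos]

lemma goldenMean_lt_one : goldenMean < 1 := by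
  linarith [goldenMean_lt]

lemma irrational_goldenMean : Irrational goldenMean :=
  Real.goldenConj_irrational.neg

lemma fib_succ_mul_goldenMean (n : ℕ) :
    (Nat.fib (n + 1) : ℝ) * goldenMean = Nat.fib n + (-1) ^ n * goldenMean ^ (n + 1) := by
  have h := Real.goldenConj_mul_fib_succ_add_fib n
  have h2 : (-1 : ℝ) ^ n * goldenMean ^ (n + 1) = -Real.goldenConj ^ (n + 1) := by
    unfold goldenMean
    rw [neg_pow Real.goldenConj (n + 1), pow_succ (-1 : ℝ) n]
    have : (-1 : ℝ) ^ n * (-1) ^ n = 1 := by rw [← mul_pow]; simp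
    linear_combination (-Real.goldenConj ^ (n + 1)) * this
  rw [h2, ← h]
  unfold goldenMean
  ring

lemma goldenMean_pow_anti {m n : ℕ} (h : m ≤ n) : goldenMean ^ n ≤ goldenMean ^ m :=
  pow_le_pow_of_le_one goldenMean_pos.le goldenMean_lt_one.le h

lemma goldenMean_inv : goldenMean⁻¹ = Real.goldenRatio := by
  rw [goldenMean, ← Real.inv_goldenRatio, inv_inv]

lemma floor_goldenRatio : ⌊Real.goldenRatio⌋ = 1 := by
  rw [Int.floor_eq_iff]
  constructor
  · exact_mod_cast Real.one_lt_goldenRatio.le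
  · have := Real.goldenRatio_lt_two
    norm_num
    linarith

lemma fract_goldenRatio : Int.fract Real.goldenRatio = goldenMean := by
  rw [Int.fract, floor_goldenRatio, goldenMean]
  have := Real.one_sub_goldenConj
  push_cast
  linarith

lemma of_get?_of_fract_eq_goldenMean {v : ℝ} (hv : Int.fract v = goldenMean) (n : ℕ) :
    (GenContFract.of v).s.get? n = some ⟨1, 1⟩ := by
  induction n generalizing v with
  | zero =>
    have h := GenContFract.of_s_head (v := v) (by rw [hv]; exact goldenMean_pos.ne')
    rw [hv, goldenMean_inv, floor_goldenRatio, Int.cast_one] at h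
    exact h
  | succ n ih => rw [GenContFract.of_s_succ, hv, goldenMean_inv, ih fract_goldenRatio]

lemma of_goldenMean_get? (n : ℕ) :
    (GenContFract.of goldenMean).s.get? n = some ⟨1, 1⟩ :=
  of_get?_of_fract_eq_goldenMean
    (Int.fract_eq_self.mpr ⟨goldenMean_pos.le, goldenMean_lt_one⟩) n

lemma cfDen_goldenMean (n : ℕ) : cfDen goldenMean n = Nat.fib (n + 1) := by
  induction n using Nat.twoStepInduction with
  | zero => simp [cfDen]
  | one => simp [cfDen, GenContFract.first_den_eq (of_goldenMean_get? 0)]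
  | more n h0 h1 =>
    have h := GenContFract.dens_recurrence (of_goldenMean_get? (n + 1)) h0 h1
    rw [cfDen, h, Nat.fib_add_two (n := n + 1)]
    push_cast
    ring

lemma one_le_three_mul_dist_goldenMean {j : ℕ} (hj : 1 ≤ j) (P : ℤ) :
    1 ≤ 3 * (j : ℝ) * |(j : ℝ) * goldenMean - P| := by
  by_contra! hlt
  have hj' : (1 : ℝ) ≤ j := by exact_mod_cast hj
  set x : ℝ := (j : ℝ) * goldenMean - P with hx
  have hnorm : x * ((j : ℝ) * (-1 - goldenMean) - P) = ((-j ^ 2 + j * P + P ^ 2 : ℤ) : ℝ) := by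
    push_cast
    rw [hx]
    linear_combination (-(j : ℝ) ^ 2) * goldenMean_sq
  have hx0 : x ≠ 0 := by
    rw [hx, sub_ne_zero]
    exact (irrational_goldenMean.natCast_mul (by omega)).ne_int P
  have hy0 : (j : ℝ) * (-1 - goldenMean) - P ≠ 0 := by
    rw [sub_ne_zero]
    intro h
    apply (irrational_goldenMean.natCast_mul (m := j) (by omega)).ne_int (-P - j)
    push_cast
    linarith
  have hz : (-j ^ 2 + j * P + P ^ 2 : ℤ) ≠ 0 := by
    intro h
    rw [h, Int.cast_zero] at hnorm
    exact mul_ne_zero hx0 hy0 hnorm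
  have h1 : (1 : ℝ) ≤ |x * ((j : ℝ) * (-1 - goldenMean) - P)| := by
    rw [hnorm]
    exact_mod_cast Int.one_le_abs hz
  have h2 : |(j : ℝ) * (-1 - goldenMean) - P| ≤ |x| + 2.24 * j := by
    have : (j : ℝ) * (-1 - goldenMean) - P = x + -(j * (1 + 2 * goldenMean)) := by rw [hx]; ring
    rw [this]
    refine (abs_add_le _ _).trans ?_
    have hα := goldenMean_pos
    rw [abs_neg, abs_of_nonneg (a := (j : ℝ) * (1 + 2 * goldenMean)) (by positivity)]
    nlinarith [goldenMean_lt]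
  rw [abs_mul] at h1
  have h3 : |x| < 1 / 3 := by nlinarith [abs_nonneg x]
  nlinarith [abs_nonneg x, mul_le_mul_of_nonneg_left h2 (abs_nonneg x)]

lemma natCast_mul_goldenMean_pow_le (j : ℕ) : (j : ℝ) * goldenMean ^ (j + 1) ≤ 1 := by
  induction j with
  | zero => simp
  | succ j ih =>
    rcases Nat.lt_or_ge j 2 with h | h
    · interval_cases j
      · simpa using pow_le_one₀ (n := 2) goldenMean_pos.le goldenMean_lt_one.le
      · have h3 : goldenMean ^ 3 = 2 * goldenMean - 1 := by
          linear_combination (goldenMean - 1) * goldenMean_sq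
        norm_num
        linarith [goldenMean_lt]
    · have hj : (2 : ℝ) ≤ j := by exact_mod_cast h
      have h1 : ((j + 1 : ℕ) : ℝ) * goldenMean ≤ j := by
        push_cast
        nlinarith [goldenMean_lt]
      have := mul_le_mul_of_nonneg_right h1 (pow_nonneg goldenMean_pos.le (j + 1))
      calc ((j + 1 : ℕ) : ℝ) * goldenMean ^ (j + 1 + 1)
          = ((j + 1 : ℕ) : ℝ) * goldenMean * goldenMean ^ (j + 1) := by ring
        _ ≤ 1 := this.trans ih

lemma fib_succ_mul_goldenMean_pow_le (n : ℕ) : (Nat.fib (n + 1) : ℝ) * goldenMean ^ n ≤ 1 := by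
  induction n using Nat.twoStepInduction with
  | zero => simp
  | one => simpa using goldenMean_lt_one.le
  | more n h0 h1 =>
    rw [Nat.fib_add_two]
    push_cast
    have e : ((Nat.fib (n + 1) : ℝ) + Nat.fib (n + 1 + 1)) * goldenMean ^ (n + 2)
      = (Nat.fib (n + 1) * goldenMean ^ n) * goldenMean ^ 2
        + (Nat.fib (n + 1 + 1) * goldenMean ^ (n + 1)) * goldenMean := by ring
    rw [e]
    nlinarith [goldenMean_sq, goldenMean_pos, sq_nonneg goldenMean]

/-- Indices of the orbit points that approximate the left endpoint of the exceptional interval. -/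
def approxIdx : ℕ → ℕ
  | 0 => 0
  | k + 1 => approxIdx k + Nat.fib (6 * approxIdx k + 3)

lemma approxIdx_add_two_le (k : ℕ) : approxIdx k + 2 ≤ approxIdx (k + 1) := by
  have : Nat.fib 3 ≤ Nat.fib (6 * approxIdx k + 3) := Nat.fib_mono (by omega)
  have h3 : Nat.fib 3 = 2 := rfl
  rw [approxIdx]
  omega

lemma approxIdx_add_le (k j : ℕ) : approxIdx k + j ≤ approxIdx (k + j) := by
  induction j with
  | zero => simp
  | succ j ih =>
    have := approxIdx_add_two_le (k + j)
    rw [← add_assoc k j 1]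
    omega

lemma even_approxIdx (k : ℕ) : Even (approxIdx k) := by
  induction k with
  | zero => simp [approxIdx]
  | succ k ih =>
    rw [approxIdx]
    refine ih.add ?_
    have h : Nat.fib 3 ∣ Nat.fib (6 * approxIdx k + 3) := Nat.fib_dvd _ _ (by omega)
    exact even_iff_two_dvd.mpr h

/-- The distance from the `approxIdx k`-th orbit point to the left endpoint of the interval. -/
noncomputable def approxTail (k : ℕ) : ℝ := ∑' j, goldenMean ^ (6 * approxIdx (k + j) + 3)

lemma approxTail_term_le (k j : ℕ) : goldenMean ^ (6 * approxIdx (k + j) + 3) ≤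
    goldenMean ^ (6 * approxIdx k + 3) * (1 / 2) ^ j := by
  have h := approxIdx_add_le k j
  calc goldenMean ^ (6 * approxIdx (k + j) + 3)
      ≤ goldenMean ^ (6 * approxIdx k + 3 + 2 * j) := goldenMean_pow_anti (by omega)
    _ = goldenMean ^ (6 * approxIdx k + 3) * (goldenMean ^ 2) ^ j := by rw [pow_add, pow_mul]
    _ ≤ _ := by
      have := goldenMean_pos
      have h2 : goldenMean ^ 2 ≤ 1 / 2 := by linarith [goldenMean_sq, goldenMean_gt]
      gcongr

lemma summable_approxTail (k : ℕ) :
    Summable fun j => goldenMean ^ (6 * approxIdx (k + j) + 3) :=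
  Summable.of_nonneg_of_le (fun _ => pow_nonneg goldenMean_pos.le _) (approxTail_term_le k)
    (summable_geometric_two.mul_left _)

lemma approxTail_le (k : ℕ) : approxTail k ≤ 2 * goldenMean ^ (6 * approxIdx k + 3) := by
  have h := (summable_approxTail k).tsum_le_tsum (approxTail_term_le k)
    (summable_geometric_two.mul_left _)
  rw [tsum_mul_left, tsum_geometric_two] at h
  rw [approxTail]
  linarith

lemma approxTail_eq (k : ℕ) :
    approxTail k = goldenMean ^ (6 * approxIdx k + 3) + approxTail (k + 1) := by
  rw [approxTail, (summable_approxTail k).tsum_eq_zero_add, approxTail]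
  simp only [add_zero, add_assoc, add_comm 1]

lemma approxTail_pos (k : ℕ) : 0 < approxTail k :=
  (summable_approxTail k).tsum_pos (fun _ => pow_nonneg goldenMean_pos.le _) 0
    (pow_pos goldenMean_pos _)

lemma approxTail_le_pow (k : ℕ) : approxTail k ≤ goldenMean ^ (approxIdx k + 1) := by
  have h := goldenMean_pow_anti (show approxIdx k + 1 + 2 ≤ 6 * approxIdx k + 3 by omega)
  rw [pow_add goldenMean (approxIdx k + 1) 2, goldenMean_sq] at h
  have := pow_pos goldenMean_pos (approxIdx k + 1)
  nlinarith [approxTail_le k, goldenMean_gt]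

lemma approxIdx_mul_goldenMean (k : ℕ) :
    ∃ P : ℤ, (approxIdx k : ℝ) * goldenMean - approxTail 0 = P - approxTail k := by
  induction k with
  | zero => exact ⟨0, by simp [approxIdx]⟩
  | succ k ih =>
    obtain ⟨P, hP⟩ := ih
    have h := fib_succ_mul_goldenMean (6 * approxIdx k + 2)
    have hev : (-1 : ℝ) ^ (6 * approxIdx k + 2) = 1 := Even.neg_one_pow ⟨3 * approxIdx k + 1, by ring⟩
    rw [hev, one_mul] at h
    refine ⟨P + Nat.fib (6 * approxIdx k + 2), ?_⟩
    rw [approxIdx]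
    push_cast
    rw [approxTail_eq k] at hP
    linarith

/-- Between two consecutive approximating indices the orbit stays away from the endpoint. -/
lemma pow_lt_dist_approxTail {k n : ℕ} (hk : 10 ≤ approxIdx k) (h1 : approxIdx k < n)
    (h2 : n < approxIdx (k + 1)) (P : ℤ) :
    goldenMean ^ n < |(n : ℝ) * goldenMean - approxTail 0 - P| := by
  have hp := pow_pos goldenMean_pos n
  have h3 : goldenMean ^ 3 = 2 * goldenMean - 1 := by
    linear_combination (goldenMean - 1) * goldenMean_sq
  have h5 : goldenMean ^ 5 = 5 * goldenMean - 3 := by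
    linear_combination goldenMean ^ 3 * goldenMean_sq + (1 - goldenMean) * h3 - 2 * goldenMean_sq
  rcases Nat.lt_or_ge n (6 * approxIdx k + 7) with hn | hn
  · obtain ⟨Q, hQ⟩ := approxIdx_mul_goldenMean k
    obtain ⟨j, rfl⟩ : ∃ j, n = approxIdx k + j := ⟨n - approxIdx k, by omega⟩
    have hj : 1 ≤ j := by omega
    have hd := one_le_three_mul_dist_goldenMean hj (P - Q)
    have ht := approxTail_le k
    have ht0 := approxTail_pos k
    set r := approxTail k
    have htri : |(j : ℝ) * goldenMean - (P - Q : ℤ)|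
        ≤ |((approxIdx k + j : ℕ) : ℝ) * goldenMean - approxTail 0 - P| + r := by
      have : (j : ℝ) * goldenMean - (P - Q : ℤ)
          = (((approxIdx k + j : ℕ) : ℝ) * goldenMean - approxTail 0 - P) + r := by
        push_cast
        linarith
      rw [this]
      refine (abs_add_le _ _).trans ?_
      rw [abs_of_pos ht0]
    by_contra! hle
    have hr : r * goldenMean ^ 3 ≤ 2 * goldenMean ^ (approxIdx k + j) := by
      have := goldenMean_pow_anti (show approxIdx k + j ≤ 6 * approxIdx k + 3 + 3 by omega)
      rw [pow_add _ _ 3] at this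
      nlinarith [pow_pos goldenMean_pos 3]
    have hr' : r ≤ 9.1 * goldenMean ^ (approxIdx k + j) := by
      rw [h3] at hr
      nlinarith [goldenMean_gt]
    have hb : (j : ℝ) * goldenMean ^ (approxIdx k + j) ≤ goldenMean ^ 9 := by
      have e : goldenMean ^ (approxIdx k + j)
          = goldenMean ^ (j + 1) * goldenMean ^ (approxIdx k - 1) := by
        rw [← pow_add]
        congr 1
        omega
      have h9 := goldenMean_pow_anti (show 9 ≤ approxIdx k - 1 by omega)
      rw [e, ← mul_assoc]
      calc _ ≤ 1 * goldenMean ^ (approxIdx k - 1) :=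
            mul_le_mul_of_nonneg_right (natCast_mul_goldenMean_pow_le j)
              (pow_nonneg goldenMean_pos.le _)
        _ ≤ _ := by rwa [one_mul]
    have h9 : goldenMean ^ 9 < 0.02 := by
      have := pow_lt_pow_left₀ goldenMean_lt goldenMean_pos.le (show 9 ≠ 0 by norm_num)
      norm_num at this ⊢
      linarith
    have hj0 : (0 : ℝ) ≤ j := Nat.cast_nonneg j
    have := mul_le_mul_of_nonneg_left (htri.trans (add_le_add hle hr')) hj0
    nlinarith
  · obtain ⟨Q, hQ⟩ := approxIdx_mul_goldenMean (k + 1)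
    obtain ⟨j, hjn⟩ : ∃ j, approxIdx (k + 1) = n + j := ⟨approxIdx (k + 1) - n, by omega⟩
    have hj : 1 ≤ j := by omega
    have hd := one_le_three_mul_dist_goldenMean hj (Q - P)
    have ht := approxTail_le (k + 1)
    have ht0 := approxTail_pos (k + 1)
    rw [hjn] at hQ ht
    push_cast at hQ
    set r := approxTail (k + 1)
    have htri : |(j : ℝ) * goldenMean - (Q - P : ℤ)|
        ≤ |(n : ℝ) * goldenMean - approxTail 0 - P| + r := by
      have : (j : ℝ) * goldenMean - (Q - P : ℤ)
          = -((n : ℝ) * goldenMean - approxTail 0 - P) + -r := by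
        push_cast
        linarith
      rw [this]
      refine (abs_add_le _ _).trans ?_
      rw [abs_neg, abs_neg, abs_of_pos ht0]
    by_contra! hle
    have hr : r ≤ 2 * goldenMean ^ n :=
      ht.trans (mul_le_mul_of_nonneg_left (goldenMean_pow_anti (by omega)) (by norm_num))
    have hjf : j ≤ Nat.fib (6 * approxIdx k + 2 + 1) := by
      rw [approxIdx] at hjn
      change j ≤ Nat.fib (6 * approxIdx k + 3)
      omega
    have hb : (j : ℝ) * goldenMean ^ n ≤ goldenMean ^ 5 := by
      calc (j : ℝ) * goldenMean ^ n
          ≤ Nat.fib (6 * approxIdx k + 2 + 1) * goldenMean ^ (6 * approxIdx k + 2 + 5) :=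
            mul_le_mul (by exact_mod_cast hjf) (goldenMean_pow_anti (by omega)) hp.le
              (Nat.cast_nonneg _)
        _ = Nat.fib (6 * approxIdx k + 2 + 1) * goldenMean ^ (6 * approxIdx k + 2)
              * goldenMean ^ 5 := by ring
        _ ≤ 1 * goldenMean ^ 5 := mul_le_mul_of_nonneg_right
              (fib_succ_mul_goldenMean_pow_le _) (pow_nonneg goldenMean_pos.le _)
        _ = _ := one_mul _
    have hj0 : (0 : ℝ) ≤ j := Nat.cast_nonneg j
    have := mul_le_mul_of_nonneg_left (htri.trans (add_le_add hle hr)) hj0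
    have hα : goldenMean < 0.6185 := by nlinarith [goldenMean_pos]
    nlinarith

/-- The indicator of `[a, b)` modulo one as a difference of floors. -/
lemma indicator_eq_floor_sub_floor {a b : ℝ} (ha : 0 ≤ a) (hab : a < b) (hb : b ≤ 1) (y : ℝ) :
    (if Int.fract y ∈ Set.Ico a b then 1 else 0 : ℤ) = ⌊y - a⌋ - ⌊y - b⌋ := by
  have h0 := Int.fract_nonneg y
  have h1 := Int.fract_lt_one y
  have hfloor (c : ℝ) (hc0 : 0 ≤ c) (hc1 : c ≤ 1) :
      ⌊y - c⌋ = ⌊y⌋ + if c ≤ Int.fract y then 0 else -1 := by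
    rw [Int.floor_eq_iff]
    have := Int.floor_add_fract y
    split_ifs with h <;> push_cast <;> constructor <;> linarith
  rw [hfloor a ha (by linarith), hfloor b (by linarith) hb]
  simp only [Set.mem_Ico]
  split_ifs <;> first | omega | (exfalso; grind)

lemma cnt_fract_eq_sum {a b : ℝ} (ha : 0 ≤ a) (hab : a < b) (hb : b ≤ 1) (y : ℕ → ℝ) (N : ℕ) :
    (cnt (fun n => Int.fract (y n)) a b N : ℤ)
      = ∑ n ∈ Finset.Icc 1 N, (⌊y n - a⌋ - ⌊y n - b⌋) := by
  rw [cnt, Finset.card_filter]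
  push_cast
  exact Finset.sum_congr rfl fun n _ => indicator_eq_floor_sub_floor ha hab hb (y n)

/-- Counting visits of `n θ + e n` to an interval of length `1 - θ`, up to a telescoping sum. -/
lemma cnt_fract_add_eq {a θ : ℝ} (ha : 0 ≤ a) (haθ : a ≤ θ) (hθ : θ < 1) (e : ℕ → ℝ) (N : ℕ) :
    (cnt (fun n => Int.fract ((n : ℝ) * θ + e n)) a (a + 1 - θ) N : ℤ)
      = ∑ n ∈ Finset.Icc 1 N, (⌊(n : ℝ) * θ + e n - a⌋ - ⌊(n : ℝ) * θ + e (n - 1) - a⌋)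
        + ⌊θ + e 0 - a⌋ - ⌊((N + 1 : ℕ) : ℝ) * θ + e N - a⌋ + N := by
  rw [cnt_fract_eq_sum ha (by linarith) (by linarith)]
  induction N with
  | zero => simp
  | succ N ih =>
    rw [Finset.sum_Icc_succ_top (by omega), Finset.sum_Icc_succ_top (by omega), ih]
    have : ((N + 1 : ℕ) : ℝ) * θ + e (N + 1) - (a + 1 - θ)
        = ((N + 1 + 1 : ℕ) : ℝ) * θ + e (N + 1) - a - 1 := by
      push_cast
      ring
    rw [this, Int.floor_sub_one]
    simp only [Nat.add_sub_cancel]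
    push_cast
    ring

lemma isBRS_natCast_mul {a θ : ℝ} (ha : 0 ≤ a) (haθ : a ≤ θ) (hθ : θ < 1) :
    IsBRS (fun n : ℕ => Int.fract ((n : ℝ) * θ)) a (a + 1 - θ) := by
  refine ⟨2, fun N _ => ?_⟩
  have h := cnt_fract_add_eq ha haθ hθ (fun _ => 0) N
  simp only [add_zero, sub_self, Finset.sum_const_zero, zero_add] at h
  have h' : (cnt (fun n : ℕ => Int.fract ((n : ℝ) * θ)) a (a + 1 - θ) N : ℝ)
      = (⌊θ - a⌋ : ℝ) - (⌊((N + 1 : ℕ) : ℝ) * θ - a⌋ : ℝ) + N := by exact_mod_cast h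
  rw [h']
  have h1 := Int.floor_le (θ - a)
  have h2 := Int.lt_floor_add_one (θ - a)
  have h3 := Int.floor_le (((N + 1 : ℕ) : ℝ) * θ - a)
  have h4 := Int.lt_floor_add_one (((N + 1 : ℕ) : ℝ) * θ - a)
  push_cast at h3 h4 ⊢
  rw [abs_le]
  constructor <;> nlinarith

/-- The signed distance from `q_n θ` to the nearest integer for the golden mean `θ`. -/
noncomputable def goldenErr (n : ℕ) : ℝ := (-1) ^ n * goldenMean ^ (n + 1)

/-- The `n`-th summand of the discrepancy difference. -/
noncomputable def floorJump (n : ℕ) : ℤ :=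
  ⌊(n : ℝ) * goldenMean + goldenErr n - approxTail 0⌋
    - ⌊(n : ℝ) * goldenMean + goldenErr (n - 1) - approxTail 0⌋

lemma goldenErr_even {n : ℕ} (h : Even n) : goldenErr n = goldenMean ^ (n + 1) := by
  rw [goldenErr, h.neg_one_pow, one_mul]

lemma goldenErr_odd {n : ℕ} (h : Odd n) : goldenErr n = -goldenMean ^ (n + 1) := by
  rw [goldenErr, h.neg_one_pow, neg_one_mul]

lemma goldenErr_pred_of_even {n : ℕ} (h0 : n ≠ 0) (h : Even n) :
    goldenErr (n - 1) = -goldenMean ^ n := by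
  rw [goldenErr_odd (Nat.Even.sub_odd (by omega) h odd_one), Nat.sub_add_cancel (by omega)]

lemma goldenErr_pred_of_odd {n : ℕ} (h : Odd n) : goldenErr (n - 1) = goldenMean ^ n := by
  have := h.pos
  rw [goldenErr_even (Nat.Odd.sub_odd h odd_one), Nat.sub_add_cancel (by omega)]

lemma floorJump_nonneg_of_even {n : ℕ} (h0 : n ≠ 0) (h : Even n) : 0 ≤ floorJump n := by
  rw [floorJump, sub_nonneg, goldenErr_even h, goldenErr_pred_of_even h0 h]
  apply Int.floor_mono
  have := pow_pos goldenMean_pos n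
  have := pow_pos goldenMean_pos (n + 1)
  linarith

lemma floor_add_eq_of_dist {x ε d : ℝ} (h : ∀ P : ℤ, d < |x - P|) (hε : |ε| ≤ d) :
    ⌊x + ε⌋ = ⌊x⌋ := by
  rw [Int.floor_eq_iff]
  have h1 := h ⌊x⌋
  have h2 := h (⌊x⌋ + 1)
  have h3 := Int.floor_le x
  have h4 := Int.lt_floor_add_one x
  rw [abs_of_nonneg (by linarith)] at h1
  rw [abs_of_nonpos (by push_cast; linarith)] at h2
  push_cast at h2
  obtain ⟨h5, h6⟩ := abs_le.mp hε
  constructor <;> linarith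

lemma floorJump_nonneg {k n : ℕ} (hk : 10 ≤ approxIdx k) (h1 : approxIdx k < n)
    (h2 : n < approxIdx (k + 1)) : 0 ≤ floorJump n := by
  rcases Nat.even_or_odd n with h | h
  · exact floorJump_nonneg_of_even (by omega) h
  · have hd := pow_lt_dist_approxTail hk h1 h2
    have hp := pow_pos goldenMean_pos n
    have hp1 := pow_pos goldenMean_pos (n + 1)
    have hle := goldenMean_pow_anti (Nat.le_succ n)
    rw [floorJump, goldenErr_odd h, goldenErr_pred_of_odd h, add_sub_right_comm,
      add_sub_right_comm, floor_add_eq_of_dist hd, floor_add_eq_of_dist hd, sub_self]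
    · rw [abs_of_pos hp]
    · rwa [abs_neg, abs_of_pos hp1]

lemma one_le_floorJump_approxIdx {k : ℕ} (hk : approxIdx k ≠ 0) :
    1 ≤ floorJump (approxIdx k) := by
  obtain ⟨P, hP⟩ := approxIdx_mul_goldenMean k
  have h1 : P ≤ ⌊(approxIdx k : ℝ) * goldenMean + goldenErr (approxIdx k) - approxTail 0⌋ := by
    rw [Int.le_floor, goldenErr_even (even_approxIdx k)]
    linarith [approxTail_le_pow k]
  have h2 : ⌊(approxIdx k : ℝ) * goldenMean + goldenErr (approxIdx k - 1) - approxTail 0⌋ < P := by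
    rw [Int.floor_lt, goldenErr_pred_of_even hk (even_approxIdx k)]
    linarith [approxTail_pos k, pow_pos goldenMean_pos (approxIdx k)]
  rw [floorJump]
  omega

lemma sum_floorJump_succ_le {k : ℕ} (hk : 10 ≤ approxIdx k) :
    ∑ n ∈ Finset.Icc 1 (approxIdx k), floorJump n + 1
      ≤ ∑ n ∈ Finset.Icc 1 (approxIdx (k + 1)), floorJump n := by
  have hlt := approxIdx_add_two_le k
  have key (m : ℕ) (hm : approxIdx k ≤ m) (hm' : m < approxIdx (k + 1)) :
      ∑ n ∈ Finset.Icc 1 (approxIdx k), floorJump n ≤ ∑ n ∈ Finset.Icc 1 m, floorJump n := by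
    apply Finset.sum_le_sum_of_subset_of_nonneg (Finset.Icc_subset_Icc_right hm)
    intro n hn hn'
    simp only [Finset.mem_Icc] at hn hn'
    exact floorJump_nonneg hk (by omega) (by omega)
  obtain ⟨m, hm⟩ : ∃ m, approxIdx (k + 1) = m + 1 := ⟨approxIdx (k + 1) - 1, by omega⟩
  have h1 := key m (by omega) (by omega)
  have h2 := one_le_floorJump_approxIdx (k := k + 1) (by omega)
  rw [hm] at h2 ⊢
  rw [Finset.sum_Icc_succ_top (by omega)]
  omega

lemma le_sum_floorJump (k : ℕ) :
    ∑ n ∈ Finset.Icc 1 (approxIdx 10), floorJump n + k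
      ≤ ∑ n ∈ Finset.Icc 1 (approxIdx (10 + k)), floorJump n := by
  induction k with
  | zero => simp
  | succ k ih =>
    have h := approxIdx_add_le 0 (10 + k)
    have := sum_floorJump_succ_le (k := 10 + k) (by simp only [zero_add] at h; omega)
    rw [← add_assoc 10 k 1]
    push_cast
    linarith

lemma fract_cfDen_goldenMean (n : ℕ) :
    Int.fract ((cfDen goldenMean n + (n : ℝ)) * goldenMean)
      = Int.fract ((n : ℝ) * goldenMean + goldenErr n) := by
  have h : (cfDen goldenMean n + (n : ℝ)) * goldenMean
      = (n : ℝ) * goldenMean + goldenErr n + (Nat.fib n : ℕ) := by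
    rw [cfDen_goldenMean, add_mul, fib_succ_mul_goldenMean, goldenErr]
    ring
  rw [h, Int.fract_add_natCast]

lemma not_isBRS_cfDen_goldenMean (ha : approxTail 0 ≤ goldenMean) :
    ¬ IsBRS (fun n : ℕ => Int.fract ((cfDen goldenMean n + (n : ℝ)) * goldenMean))
      (approxTail 0) (approxTail 0 + 1 - goldenMean) := by
  rintro ⟨c, hc⟩
  simp only [fract_cfDen_goldenMean] at hc
  set S := ∑ n ∈ Finset.Icc 1 (approxIdx 10), floorJump n
  set F := ⌊goldenMean + goldenErr 0 - approxTail 0⌋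
  obtain ⟨k, hk⟩ := exists_nat_gt (c + 2 - S - F)
  set N := approxIdx (10 + k)
  have hNpos : 1 ≤ N := by
    have := approxIdx_add_le 0 (10 + k)
    simp only [zero_add] at this
    omega
  have h1 := hc N hNpos
  have h2 := cnt_fract_add_eq (approxTail_pos 0).le ha goldenMean_lt_one goldenErr N
  have h3 : (S : ℝ) + k ≤ ((∑ n ∈ Finset.Icc 1 N, floorJump n : ℤ) : ℝ) := by
    exact_mod_cast le_sum_floorJump k
  have h4 : (cnt (fun n => Int.fract ((n : ℝ) * goldenMean + goldenErr n)) (approxTail 0)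
      (approxTail 0 + 1 - goldenMean) N : ℝ) = ((∑ n ∈ Finset.Icc 1 N, floorJump n : ℤ) : ℝ)
        + F - (⌊((N + 1 : ℕ) : ℝ) * goldenMean + goldenErr N - approxTail 0⌋ : ℝ) + N := by
    exact_mod_cast h2
  have h5 := Int.floor_le (((N + 1 : ℕ) : ℝ) * goldenMean + goldenErr N - approxTail 0)
  have h6 : goldenErr N ≤ 1 := by
    rw [goldenErr_even (even_approxIdx _)]
    exact pow_le_one₀ goldenMean_pos.le goldenMean_lt_one.le
  have h7 := (le_abs_self _).trans h1
  have h8 := approxTail_pos 0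
  push_cast at h4 h5 h3
  linarith [goldenMean_lt_one]

/-- there exists an irrational `α` and an interval `J = [a, b) ⊆ [0,1)`
which is a BRS for `({n α})_{n ≥ 1}` but not a BRS for `({(q_n + n) α})_{n ≥ 1}`.
In particular the two sequences do not in general have the same collection of BRS. -/
theorem exists_brs_not_brs_for_qn_plus_n :
    ∃ α : ℝ, Irrational α ∧ ∃ a b : ℝ, 0 ≤ a ∧ a < b ∧ b ≤ 1 ∧
      IsBRS (fun n : ℕ => Int.fract ((n : ℝ) * α)) a b ∧
      ¬ IsBRS (fun n : ℕ => Int.fract ((cfDen α n + (n : ℝ)) * α)) a b := by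
  have ha : approxTail 0 ≤ goldenMean := by
    simpa [approxIdx] using approxTail_le_pow 0
  exact ⟨goldenMean, irrational_goldenMean, approxTail 0, approxTail 0 + 1 - goldenMean,
    (approxTail_pos 0).le, by linarith [goldenMean_lt_one], by linarith,
    isBRS_natCast_mul (approxTail_pos 0).le ha goldenMean_lt_one, not_isBRS_cfDen_goldenMean ha⟩
end

section
/- Let (a_n)_{n≥1} be a nondecreasing sequence of positive integers with lim_{n→∞} a_n/n = 0, let α be a real number, and suppose ({a_n α})_{n≥1} is uniformly distributed modulo 1. Then every interval [a,b) ⊊ [0,1) of positive measure is a strongly non-bounded remainder set (S-NBRS) for ({a_n α})_{n≥1}. -/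
open Finset Filter

/-- A monotone sequence of natural numbers of sublinear growth is constant on arbitrarily long
blocks. -/
theorem exists_apply_add_eq_of_sublinear (a : ℕ → ℕ) (hmono : Monotone a)
    (hslow : Tendsto (fun n : ℕ => (a n : ℝ) / (n : ℝ)) atTop (nhds 0)) (K : ℕ) :
    ∃ N : ℕ, a (N + K) = a N := by
  by_contra! h
  have hK : 0 < K := Nat.pos_of_ne_zero fun hK => h 0 (by simp [hK])
  have hgrow : ∀ m : ℕ, m ≤ a (m * K) := by
    intro m
    induction m with
    | zero => exact Nat.zero_le _
    | succ m ih =>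
      have hlt : a (m * K) < a (m * K + K) :=
        lt_of_le_of_ne (hmono (Nat.le_add_right _ _)) (h (m * K)).symm
      rw [Nat.succ_mul]
      omega
  have hKR : (0 : ℝ) < K := by exact_mod_cast hK
  obtain ⟨M, hM⟩ := eventually_atTop.1 (hslow.eventually_lt_const (inv_pos.2 hKR))
  have hlt := hM ((M + 1) * K) (by nlinarith)
  have hpos : (0 : ℝ) < ((M + 1) * K : ℕ) := by positivity
  rw [div_lt_iff₀ hpos] at hlt
  have hge : ((M + 1 : ℕ) : ℝ) ≤ a ((M + 1) * K) := by exact_mod_cast hgrow (M + 1)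
  have heq : (K : ℝ)⁻¹ * ((M + 1) * K : ℕ) = ((M + 1 : ℕ) : ℝ) := by
    push_cast
    field_simp
  linarith

/-- if `(a_n)` is a nondecreasing sequence of positive integers with
`a_n / n → 0` and `({a_n α})_{n ≥ 1}` is uniformly distributed mod 1, then every
interval `[c, d) ⊊ [0,1)` of positive measure is an S-NBRS for `({a_n α})_{n ≥ 1}`. -/
theorem snbrs_of_sublinear_growth (a : ℕ → ℕ) (hmono : Monotone a)
    (hpos : ∀ n : ℕ, 1 ≤ n → 1 ≤ a n)
    (hslow : Filter.Tendsto (fun n : ℕ => (a n : ℝ) / (n : ℝ)) Filter.atTop (nhds 0))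
    (α : ℝ) (hud : IsUD (fun n : ℕ => Int.fract ((a n : ℝ) * α)))
    (c d : ℝ) (hc : 0 ≤ c) (hcd : c < d) (hd : d ≤ 1) (hproper : ¬(c = 0 ∧ d = 1)) :
    IsSNBRS (fun n : ℕ => Int.fract ((a n : ℝ) * α)) c d := by
  intro K
  obtain ⟨N, hN⟩ := exists_apply_add_eq_of_sublinear a hmono hslow K
  have hconst : ∀ k : ℕ, k ≤ K → a (N + k) = a N := fun k hk =>
    le_antisymm (hN ▸ hmono (Nat.add_le_add_left hk N)) (hmono (Nat.le_add_right N k))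
  refine ⟨N, ?_⟩
  by_cases hmem : Int.fract ((a N : ℝ) * α) ∈ Set.Ico c d
  · exact Or.inl fun k _ hk => by simpa only [hconst k hk] using hmem
  · exact Or.inr fun k _ hk => by simpa only [hconst k hk] using hmem
end
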